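/- arXiv:math/0702451 — 11 statements merged into one kernel-verified Lean document; each statement's English description precedes it below -/
import Mathlib

section
/- Let (R, m) be a finite local commutative ring whose cardinality is q^2, where q = p^d for a prime p and a positive integer d, such that the residue field R/m has q elements and the characteristic of R is p^2. Then there exists a monic polynomial f of degree d in (Z/p^2 Z)[x] whose image in (Z/pZ)[x] (under reduction of coefficients mod p) is irreducible, such that R is isomorphic as a ring to (Z/p^2 Z)[x]/(f). -/
open Polynomial

/-- A finite local commutative ring of cardinality `q^2` with residue field of
cardinality `q = p^d` and characteristic `p^2` is isomorphic to `(ZMod (p^2))[X] ⧸ (f)` for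
some monic polynomial `f` of degree `d` whose image mod `p` is irreducible. -/
theorem stmt0 (p d : ℕ) (hp : p.Prime) (hd : 0 < d)
    (R : Type*) [CommRing R] [IsLocalRing R] [Finite R]
    (hcard : Nat.card R = (p ^ d) ^ 2)
    (hres : Nat.card (IsLocalRing.ResidueField R) = p ^ d)
    (hchar : ringChar R = p ^ 2) :
    ∃ f : (ZMod (p ^ 2))[X], f.Monic ∧ f.natDegree = d ∧
      Irreducible (f.map (ZMod.castHom (dvd_pow_self p (by norm_num : (2 : ℕ) ≠ 0)) (ZMod p))) ∧
      Nonempty (R ≃+* ((ZMod (p ^ 2))[X] ⧸ Ideal.span {f})) := by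
  haveI : Fact p.Prime := ⟨hp⟩
  haveI : CharP R (p ^ 2) := hchar ▸ ringChar.charP R
  have hp2 : (p : R) * p = 0 := by
    have := CharP.cast_eq_zero R (p ^ 2)
    rw [← this]; push_cast; ring
  have hp0 : (p : R) ≠ 0 := by
    intro h
    have h1 := (CharP.cast_eq_zero_iff R (p ^ 2) p).1 h
    have h2 := Nat.le_of_dvd hp.pos h1
    have := hp.two_le
    nlinarith
  set k := IsLocalRing.ResidueField R with hk
  haveI : Finite k := Finite.of_surjective _ IsLocalRing.residue_surjective
  let res : R →+* k := IsLocalRing.residue R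
  have hres0 : ∀ r : R, res r = 0 ↔ r ∈ IsLocalRing.maximalIdeal R := fun r =>
    IsLocalRing.residue_eq_zero_iff r
  have hpk : (p : k) = 0 := by
    have : (p : k) * p = 0 := by
      have := congrArg res hp2
      simpa using this
    simpa using this
  haveI : CharP k p := by
    have h := (CharP.charP_iff_prime_eq_zero (R := k) hp).2 hpk
    exact h
  have hpm : (p : R) ∈ IsLocalRing.maximalIdeal R := by
    rw [← hres0]; simpa using hpk
  -- the card of m
  have hm : Nat.card (IsLocalRing.maximalIdeal R) = p ^ d := by
    have h := Submodule.card_eq_card_quotient_mul_card (IsLocalRing.maximalIdeal R)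
    have h' : Nat.card (R ⧸ IsLocalRing.maximalIdeal R) = p ^ d := hres
    rw [h', hcard, sq] at h
    have := Nat.pow_pos (n := d) hp.pos
    first
      | exact (Nat.eq_of_mul_eq_mul_left this h).symm
      | exact (Nat.eq_of_mul_eq_mul_right this h).symm
  let μ : R →ₗ[R] R := LinearMap.mulLeft R (p : R)
  have hker : LinearMap.ker μ ≤ IsLocalRing.maximalIdeal R := by
    apply IsLocalRing.le_maximalIdeal
    intro h
    have : (1 : R) ∈ LinearMap.ker μ := by rw [h]; trivial
    exact hp0 (by simpa [μ] using this)
  have hran : LinearMap.range μ ≤ IsLocalRing.maximalIdeal R := by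
    rintro _ ⟨r, rfl⟩
    exact Ideal.mul_mem_right _ _ hpm
  have hkr : (p ^ d) * (p ^ d) = Nat.card (LinearMap.range μ) * Nat.card (LinearMap.ker μ) := by
    have h := Submodule.card_eq_card_quotient_mul_card (LinearMap.ker μ)
    rw [hcard, Nat.card_congr μ.quotKerEquivRange.toEquiv, sq] at h
    rw [h]; try ring
  have h1 : Nat.card (LinearMap.ker μ) ≤ p ^ d := by
    rw [← hm]; exact Nat.card_mono (Set.toFinite _) hker
  have h2 : Nat.card (LinearMap.range μ) ≤ p ^ d := by
    rw [← hm]; exact Nat.card_mono (Set.toFinite _) hran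
  have hpos : 0 < p ^ d := Nat.pow_pos hp.pos
  have h3 : Nat.card (LinearMap.ker μ) = p ^ d := by nlinarith
  have h4 : Nat.card (LinearMap.range μ) = p ^ d := by nlinarith
  have hkerEq : ∀ r ∈ IsLocalRing.maximalIdeal R, (p : R) * r = 0 := by
    have : (LinearMap.ker μ : Set R) = IsLocalRing.maximalIdeal R :=
      Set.eq_of_subset_of_ncard_le hker
        (by rw [← Nat.card_coe_set_eq, ← Nat.card_coe_set_eq]; exact (hm.trans h3.symm).le)
        (Set.toFinite _)
    intro r hr
    have : r ∈ (LinearMap.ker μ : Set R) := this ▸ hr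
    simpa [μ] using this
  have hranEq : ∀ r ∈ IsLocalRing.maximalIdeal R, ∃ s, (p : R) * s = r := by
    have : (LinearMap.range μ : Set R) = IsLocalRing.maximalIdeal R :=
      Set.eq_of_subset_of_ncard_le hran
        (by rw [← Nat.card_coe_set_eq, ← Nat.card_coe_set_eq]; exact (hm.trans h4.symm).le)
        (Set.toFinite _)
    intro r hr
    have : r ∈ (LinearMap.range μ : Set R) := this ▸ hr
    simpa [μ] using this
  -- the residue field
  letI : Algebra (ZMod p) k := ZMod.algebra k p
  have hfin : Module.finrank (ZMod p) k = d := by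
    have h := Module.natCard_eq_pow_finrank (K := ZMod p) (V := k)
    rw [hres, Nat.card_zmod] at h
    exact (Nat.pow_right_injective hp.two_le h).symm
  obtain ⟨b, hb⟩ := Field.exists_primitive_element (ZMod p) k
  have hbint : IsIntegral (ZMod p) b := Algebra.IsIntegral.isIntegral b
  have hdeg : (minpoly (ZMod p) b).natDegree = d := by
    rw [← hfin]; exact (Field.primitive_element_iff_minpoly_natDegree_eq _ b).1 hb
  have hsurj : ∀ y : k, ∃ h : (ZMod p)[X], h.degree < (minpoly (ZMod p) b).degree ∧
      aeval b h = y := by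
    intro y
    have hy : y ∈ Algebra.adjoin (ZMod p) {b} := by
      have : (IntermediateField.adjoin (ZMod p) {b}).toSubalgebra = Algebra.adjoin (ZMod p) {b} :=
        IntermediateField.adjoin_simple_toSubalgebra_of_isAlgebraic hbint.isAlgebraic
      rw [← this, hb]; trivial
    rw [Algebra.adjoin_singleton_eq_range_aeval] at hy
    obtain ⟨h, rfl⟩ := hy
    refine ⟨h %ₘ minpoly (ZMod p) b, degree_modByMonic_lt _ (minpoly.monic hbint), ?_⟩
    exact aeval_modByMonic_eq_self_of_root (minpoly.aeval _ _)
  obtain ⟨a, ha⟩ : ∃ a, res a = b := IsLocalRing.residue_surjective b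
  let c : ZMod (p ^ 2) →+* ZMod p :=
    ZMod.castHom (dvd_pow_self p (by norm_num : (2 : ℕ) ≠ 0)) (ZMod p)
  have hc : Function.Surjective c := ZMod.castHom_surjective _
  let e : (ZMod (p ^ 2))[X] →+* R := eval₂RingHom (ZMod.castHom dvd_rfl R) a
  have hcomp : ∀ h : (ZMod (p ^ 2))[X], res (e h) = aeval b (h.map c) := by
    have : res.comp e = ((aeval b : (ZMod p)[X] →ₐ[ZMod p] k) : (ZMod p)[X] →+* k).comp
        (mapRingHom c) := by
      apply Polynomial.ringHom_ext'
      · exact Subsingleton.elim _ _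
      · simp [e, ha]
    intro h
    simpa using congrArg (fun F => F h) this
  have hlift : ∀ y : k, ∃ h : (ZMod (p ^ 2))[X], h.degree < (minpoly (ZMod p) b).degree ∧
      res (e h) = y := by
    intro y
    obtain ⟨h, hh, rfl⟩ := hsurj y
    have hl : h ∈ lifts c := by
      rw [lifts_iff_coeff_lifts]; intro n; exact hc _
    obtain ⟨g, hg, hg'⟩ := exists_degree_eq_of_mem_lifts hl
    exact ⟨g, hg' ▸ hh, by rw [hcomp, hg]⟩
  have hl : minpoly (ZMod p) b ∈ lifts c := by
    rw [lifts_iff_coeff_lifts]; intro n; exact hc _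
  haveI : Fact (1 < p ^ 2) := ⟨Nat.one_lt_pow (by norm_num) hp.one_lt⟩
  obtain ⟨f0, hf0, hf0d, hf0m⟩ := lifts_and_degree_eq_and_monic hl (minpoly.monic hbint)
  have hf0e : e f0 ∈ IsLocalRing.maximalIdeal R := by
    rw [← hres0, hcomp, hf0, minpoly.aeval]
  obtain ⟨r, hr⟩ := hranEq _ hf0e
  obtain ⟨h, hhd, hh⟩ := hlift (res r)
  have hpm0 : ∀ x y : R, res x = res y → (p : R) * x = p * y := by
    intro x y hxy
    have := hkerEq (x - y) (by rw [← hres0, map_sub, hxy, sub_self])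
    rw [mul_sub] at this
    exact sub_eq_zero.1 this
  let f := f0 - (p : (ZMod (p ^ 2))[X]) * h
  have hlt : ((p : (ZMod (p ^ 2))[X]) * h).degree < f0.degree := by
    rw [hf0d]
    refine lt_of_le_of_lt ?_ hhd
    rw [← nsmul_eq_mul]
    exact degree_smul_le _ _
  have hfm : f.Monic := hf0m.sub_of_left hlt
  have hfd : f.natDegree = d := by
    rw [← hdeg]
    apply natDegree_eq_of_degree_eq
    rw [← hf0d]
    exact degree_sub_eq_left_of_degree_lt hlt
  have hfc : f.map c = minpoly (ZMod p) b := by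
    simp [f, hf0, Polynomial.map_sub, Polynomial.map_mul]
  have hfe : e f = 0 := by
    have : e f = e f0 - p * e h := by simp only [f, map_sub, map_mul, map_natCast]
    rw [this, ← hr, hpm0 _ _ hh, sub_self]
  have hesurj : Function.Surjective e := by
    intro x
    obtain ⟨g, -, hg⟩ := hlift (res x)
    obtain ⟨s, hs⟩ := hranEq (x - e g) (by rw [← hres0, map_sub, hg, sub_self])
    obtain ⟨g', -, hg'⟩ := hlift (res s)
    refine ⟨g + p * g', ?_⟩
    rw [map_add, map_mul, map_natCast, hpm0 _ _ hg', hs]; ring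
  refine ⟨f, hfm, hfd, ?_, ?_⟩
  · change Irreducible (f.map c)
    rw [hfc]; exact minpoly.irreducible hbint
  · let φ : ((ZMod (p ^ 2))[X] ⧸ Ideal.span {f}) →+* R := Ideal.Quotient.lift _ e (by
      intro x hx
      obtain ⟨y, rfl⟩ := Ideal.mem_span_singleton.1 hx
      rw [map_mul, hfe, zero_mul])
    have hφ : Function.Surjective φ := Ideal.Quotient.lift_surjective_of_surjective _ _ hesurj
    have E : ((ZMod (p ^ 2))[X] ⧸ Ideal.span {f}) ≃ (Fin f.natDegree → ZMod (p ^ 2)) :=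
      (AdjoinRoot.powerBasis' hfm).basis.equivFun.toEquiv
    haveI : NeZero (p ^ 2) := ⟨pow_ne_zero _ hp.ne_zero⟩
    haveI : Finite ((ZMod (p ^ 2))[X] ⧸ Ideal.span {f}) := Finite.of_equiv _ E.symm
    have hc1 : Nat.card ((ZMod (p ^ 2))[X] ⧸ Ideal.span {f}) = Nat.card R := by
      rw [Nat.card_congr E, hcard, Nat.card_fun, hfd]
      simp [← pow_mul, mul_comm]
    have hbij : Function.Bijective φ := (Nat.bijective_iff_surjective_and_card φ).2 ⟨hφ, hc1⟩
    exact ⟨(RingEquiv.ofBijective φ hbij).symm⟩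
end

section
/- Let (R, m) be a finite local commutative ring with |R| = 64 whose residue field R/m has 8 elements. If the characteristic of R is 4, then R is isomorphic as a ring to (Z/4Z)[x]/(x^3 + x + 1). -/
open Polynomial

lemma aux_parity {K : Type*} [Field K] (h2 : (2 : K) = 0) (a : K) (ha : a ^ 3 + a + 1 = 0)
    (x y z : ℕ) (h : (x : K) + y * a + z * a ^ 2 = 0) : Even x ∧ Even y ∧ Even z := by
  have h0 : a ≠ 0 := by
    rintro rfl
    simp at ha
  have h1 : a + 1 ≠ 0 := by
    intro h
    have : (1 : K) = 0 := by linear_combination ha - (a ^ 2 - a + 2) * h + h2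
    exact one_ne_zero this
  have h3 : a ^ 2 + a + 1 ≠ 0 := by
    intro h
    have : a = 0 := by linear_combination ha - (a - 1) * h - h2
    exact h0 this
  have key : ∀ n : ℕ, (Even n ∧ (n : K) = 0) ∨ (¬ Even n ∧ (n : K) = 1) := by
    intro n
    rcases Nat.even_or_odd' n with ⟨k, rfl | rfl⟩
    · left; simp [h2]
    · right; constructor
      · simp
      · push_cast; rw [h2]; ring
  have h4 : (1 : K) ≠ 0 := one_ne_zero
  rcases key x with ⟨ex, hx⟩ | ⟨ex, hx⟩ <;> rcases key y with ⟨ey, hy⟩ | ⟨ey, hy⟩ <;>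
    rcases key z with ⟨ez, hz⟩ | ⟨ez, hz⟩ <;> rw [hx, hy, hz] at h
  · exact ⟨ex, ey, ez⟩
  · exact absurd (by linear_combination h) (pow_ne_zero 2 h0)
  · exact absurd (by linear_combination h) h0
  · exact absurd (by linear_combination h) (mul_ne_zero h0 h1)
  · exact absurd (by linear_combination h) h4
  · exact absurd (by linear_combination h + a * h2) (pow_ne_zero 2 h1)
  · exact absurd (by linear_combination h) h1
  · exact absurd (by linear_combination h) h3

lemma aux_root {K : Type*} [Field K] (hK : Nat.card K = 8) :
    (2 : K) = 0 ∧ ∃ a : K, a ^ 3 + a + 1 = 0 := by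
  have : Finite K := Nat.finite_of_card_ne_zero (by omega)
  have := Fintype.ofFinite K
  classical
  have hc : Fintype.card K = 8 := by rw [← Nat.card_eq_fintype_card, hK]
  have h2 : (2 : K) = 0 := by
    have : ((Fintype.card K : ℕ) : K) = 0 := Nat.cast_card_eq_zero K
    rw [hc] at this
    have h : (2 : K) ^ 3 = 0 := by push_cast at this; linear_combination this
    exact pow_eq_zero_iff (by norm_num) |>.1 h
  refine ⟨h2, ?_⟩
  obtain ⟨b, hb⟩ : ∃ b : K, b ∉ ({0, 1} : Finset K) := by
    by_contra! h
    have := Finset.card_le_card (fun x _ => h x : (Finset.univ : Finset K) ⊆ {0, 1})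
    have h' := Finset.card_le_two (a := (0 : K)) (b := 1)
    rw [Finset.card_univ, hc] at this
    omega
  simp only [Finset.mem_insert, Finset.mem_singleton, not_or] at hb
  have h8 : b ^ 8 = b := by
    have := FiniteField.pow_card b
    rwa [hc] at this
  have hm : (b * (b - 1)) * ((b ^ 3 + b + 1) * (b ^ 3 + b ^ 2 + 1)) = 0 := by
    linear_combination h8 + (b ^ 5 - b ^ 4) * h2
  have hne : b * (b - 1) ≠ 0 := mul_ne_zero hb.1 (sub_ne_zero.2 hb.2)
  rcases mul_eq_zero.1 ((mul_eq_zero.1 hm).resolve_left hne) with h | h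
  · exact ⟨b, h⟩
  · refine ⟨b⁻¹, ?_⟩
    have := hb.1
    field_simp
    linear_combination h

theorem stmt1 (R : Type*) [CommRing R] [IsLocalRing R] [Finite R]
    (hcard : Nat.card R = 64)
    (hres : Nat.card (IsLocalRing.ResidueField R) = 8)
    (hchar : ringChar R = 4) :
    Nonempty (R ≃+* ((ZMod 4)[X] ⧸ Ideal.span {(X : (ZMod 4)[X]) ^ 3 + X + 1})) := by
  have : CharP R 4 := hchar ▸ ringChar.charP R
  have h4 : (4 : R) = 0 := by exact_mod_cast CharP.cast_eq_zero R 4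
  have h2 : (2 : R) ≠ 0 := by
    intro h
    have : ((2 : ℕ) : R) = 0 := by exact_mod_cast h
    rw [CharP.cast_eq_zero_iff R 4] at this
    omega
  obtain ⟨k2, a, ha⟩ := aux_root hres
  set m := IsLocalRing.maximalIdeal R with hm
  have resz : ∀ x : R, IsLocalRing.residue R x = 0 ↔ x ∈ m := fun x =>
    IsLocalRing.residue_eq_zero_iff x
  have h2m : (2 : R) ∈ m := by rw [← resz, map_ofNat]; exact k2
  -- cardinality of m
  have hmc : Nat.card m = 8 := by
    have := AddSubgroup.card_eq_card_quotient_mul_card_addSubgroup m.toAddSubgroup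
    have e : Nat.card (R ⧸ m.toAddSubgroup) = 8 := hres
    rw [hcard, e] at this
    change 64 = 8 * Nat.card m at this
    omega
  let μ : R →+ R := AddMonoidHom.mulLeft 2
  have hker : μ.ker ≤ m.toAddSubgroup := by
    intro x hx
    have hx : 2 * x = 0 := hx
    change x ∈ m
    rw [hm, IsLocalRing.mem_maximalIdeal]
    intro hu
    exact h2 ((hu.mul_left_eq_zero).1 hx)
  have hran : μ.range ≤ m.toAddSubgroup := by
    rintro _ ⟨x, rfl⟩
    exact m.mul_mem_right x h2m
  have hprod : 64 = Nat.card μ.range * Nat.card μ.ker := by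
    have := AddSubgroup.card_eq_card_quotient_mul_card_addSubgroup μ.ker
    rwa [hcard, Nat.card_congr (QuotientAddGroup.quotientKerEquivRange μ).toEquiv] at this
  have hmc' : Nat.card m.toAddSubgroup = 8 := hmc
  have hk8 : Nat.card μ.ker ≤ 8 := hmc' ▸ AddSubgroup.card_le_of_le hker
  have hr8 : Nat.card μ.range ≤ 8 := hmc' ▸ AddSubgroup.card_le_of_le hran
  have hr : Nat.card μ.range = 8 := by nlinarith
  have hreq : μ.range = m.toAddSubgroup :=
    AddSubgroup.eq_of_le_of_card_ge hran (by rw [hmc', hr])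
  have hdiv : ∀ x ∈ m, ∃ y, x = 2 * y := by
    intro x hx
    have : x ∈ μ.range := by rw [hreq]; exact hx
    obtain ⟨y, hy⟩ := this
    exact ⟨y, hy.symm⟩
  -- lift the root
  obtain ⟨r0, hr0⟩ := IsLocalRing.residue_surjective (R := R) a
  obtain ⟨s, hs⟩ := hdiv (r0 ^ 3 + r0 + 1) (by rw [← resz]; simp [hr0, ha])
  have hu : IsUnit (3 * r0 ^ 2 + 1) := by
    rw [← IsLocalRing.notMem_maximalIdeal, ← hm, ← resz]
    simp only [map_add, map_mul, map_pow, hr0, map_one, map_ofNat]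
    intro h
    have h' : ((1 : ℕ) : IsLocalRing.ResidueField R) + (0 : ℕ) * a + (1 : ℕ) * a ^ 2 = 0 := by
      push_cast
      linear_combination h - a ^ 2 * k2
    have := (aux_parity k2 a ha 1 0 1 h').1
    simp at this
  obtain ⟨u, hu⟩ := hu.exists_right_inv
  obtain ⟨r, hrr, hra⟩ : ∃ r : R, r ^ 3 + r + 1 = 0 ∧ IsLocalRing.residue R r = a := by
    refine ⟨r0 - 2 * (s * u), ?_, ?_⟩
    · linear_combination hs - 2 * s * hu + (3 * r0 * (s * u) ^ 2 - 2 * (s * u) ^ 3) * h4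
    · simp only [map_sub, map_mul, map_ofNat, k2, hr0, zero_mul, sub_zero]
  have hpar : ∀ x y z : ℕ, (x : R) + y * r + z * r ^ 2 ∈ m → Even x ∧ Even y ∧ Even z := by
    intro x y z h
    rw [← resz] at h
    simp only [map_add, map_mul, map_pow, hra, map_natCast] at h
    exact aux_parity k2 a ha x y z h
  have hfour : ∀ x y z : ℕ, (x : R) + y * r + z * r ^ 2 = 0 → 4 ∣ x ∧ 4 ∣ y ∧ 4 ∣ z := by
    intro x y z h
    obtain ⟨⟨x', rfl⟩, ⟨y', rfl⟩, ⟨z', rfl⟩⟩ := hpar x y z (h ▸ m.zero_mem)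
    have : (x' : R) + y' * r + z' * r ^ 2 ∈ m := by
      refine hker (?_ : _ ∈ μ.ker)
      change 2 * ((x' : R) + y' * r + z' * r ^ 2) = 0
      push_cast at h
      linear_combination h
    obtain ⟨⟨x', rfl⟩, ⟨y', rfl⟩, ⟨z', rfl⟩⟩ := hpar _ _ _ this
    omega
  -- the map
  set f : (ZMod 4)[X] := X ^ 3 + X + 1 with hf
  have hdeg : f.natDegree = 3 := by rw [hf]; compute_degree!
  have hmon : f.Monic := by rw [hf]; monicity!
  have : Fact (1 < 4) := ⟨by norm_num⟩
  let i : ZMod 4 →+* R := ZMod.castHom dvd_rfl R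
  have hi : ∀ c : ZMod 4, i c = ((c.val : ℕ) : R) := fun c => by
    rw [← map_natCast i, ZMod.natCast_zmod_val]
  let φ : AdjoinRoot f →+* R := AdjoinRoot.lift i r (by simp [hf, hrr])
  have hinj : Function.Injective φ := by
    rw [injective_iff_map_eq_zero]
    intro x hx
    obtain ⟨p, rfl⟩ := AdjoinRoot.mk_surjective x
    rw [← AdjoinRoot.mk_leftInverse hmon (AdjoinRoot.mk f p), AdjoinRoot.modByMonicHom_mk] at hx ⊢
    have hd : (p %ₘ f).natDegree < 3 := hdeg ▸ natDegree_modByMonic_lt p hmon (by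
      intro h; rw [h] at hdeg; simp at hdeg)
    generalize p %ₘ f = q at hx hd
    simp only [φ, AdjoinRoot.lift_mk] at hx
    rw [eval₂_eq_sum_range' i hd r] at hx
    simp only [Finset.sum_range_succ, Finset.sum_range_zero, hi] at hx
    obtain ⟨d0, d1, d2⟩ := hfour (q.coeff 0).val (q.coeff 1).val (q.coeff 2).val (by linear_combination hx)
    have hz : ∀ c : ZMod 4, 4 ∣ c.val → c = 0 := by decide
    have hq : q = 0 := by
      ext n
      by_cases hn : n < 3
      · interval_cases n
        · simpa using hz _ d0
        · simpa using hz _ d1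
        · simpa using hz _ d2
      · rw [coeff_eq_zero_of_natDegree_lt (by omega)]; simp
    rw [hq, map_zero]
  have hcq : Nat.card (AdjoinRoot f) = 64 := by
    rw [Nat.card_congr (AdjoinRoot.powerBasis' hmon).basis.equivFun.toEquiv]
    simp [hdeg]
  have : Finite (AdjoinRoot f) := Nat.finite_of_card_ne_zero (by omega)
  have hbij : Function.Bijective φ :=
    (Nat.bijective_iff_injective_and_card φ).2 ⟨hinj, by rw [hcq, hcard]⟩
  exact ⟨(RingEquiv.ofBijective φ hbij).symm⟩
end

section
/- Let (R, m) be a finite local commutative ring with |R| = 16 whose residue field R/m has 4 elements. If the characteristic of R is 4, then R is isomorphic as a ring to (Z/4Z)[x]/(x^2 + x + 1). -/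
open Polynomial

lemma aux_units (R : Type*) [CommRing R] [IsLocalRing R] [Finite R]
    (hcard : Nat.card R = 16)
    (hres : Nat.card (IsLocalRing.ResidueField R) = 4) : Nat.card Rˣ = 12 := by
  classical
  have h1 : Nat.card R = Nat.card (IsLocalRing.maximalIdeal R) *
      Nat.card (IsLocalRing.ResidueField R) :=
    Submodule.card_eq_card_quotient_mul_card (IsLocalRing.maximalIdeal R)
  have h2 : Nat.card Rˣ = Nat.card {x : R // IsUnit x} :=
    Nat.card_congr (Equiv.ofBijective (fun u : Rˣ => (⟨u, u.isUnit⟩ : {x : R // IsUnit x}))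
      ⟨fun u v h => Units.ext (congrArg Subtype.val h), fun ⟨_, ⟨u, h⟩⟩ => ⟨u, Subtype.ext h⟩⟩)
  have h3 : Nat.card {x : R // IsUnit x} + Nat.card {x : R // ¬ IsUnit x} = Nat.card R := by
    rw [← Nat.card_sum]
    exact Nat.card_congr (Equiv.sumCompl _)
  have h4 : Nat.card {x : R // ¬ IsUnit x} = Nat.card (IsLocalRing.maximalIdeal R) :=
    Nat.card_congr (Equiv.subtypeEquivRight (fun x => by simp))
  rw [hcard, hres] at h1
  omega

lemma aux_root_s2 (R : Type*) [CommRing R] [IsLocalRing R] [Finite R]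
    (hcard : Nat.card R = 16)
    (hres : Nat.card (IsLocalRing.ResidueField R) = 4) : ∃ w : R, w ^ 2 + w + 1 = 0 := by
  classical
  have hu := aux_units R hcard hres
  have : Finite (IsLocalRing.ResidueField R) := Nat.finite_of_card_ne_zero (by omega)
  have : Fintype (IsLocalRing.ResidueField R) :=
    Fintype.ofFinite _
  obtain ⟨k, hk⟩ : ∃ k : IsLocalRing.ResidueField R, k ∉ ({0, 1} : Finset _) := by
    by_contra! h
    have h1 : (Finset.univ : Finset (IsLocalRing.ResidueField R)) ⊆ {0, 1} := fun x _ => h x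
    have h2 := (Finset.card_le_card h1).trans Finset.card_le_two
    rw [Finset.card_univ, ← Nat.card_eq_fintype_card, hres] at h2
    omega
  obtain ⟨b, rfl⟩ := IsLocalRing.residue_surjective k
  simp only [Finset.mem_insert, Finset.mem_singleton, not_or] at hk
  have hb : IsUnit b := by
    by_contra h
    exact hk.1 ((IsLocalRing.residue_eq_zero_iff b).2 h)
  have h12 : b ^ 12 = 1 := by
    obtain ⟨u, rfl⟩ := hb
    have := pow_card_eq_one' (x := u)
    rw [hu] at this
    rw [← Units.val_pow_eq_pow_val, this, Units.val_one]
  have hr4 : IsLocalRing.residue R b ^ 4 = IsLocalRing.residue R b := by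
    have := FiniteField.pow_card (IsLocalRing.residue R b)
    rwa [← Nat.card_eq_fintype_card, hres] at this
  have hw : IsUnit (b ^ 4 - 1) := by
    by_contra h
    have := (IsLocalRing.residue_eq_zero_iff (b ^ 4 - 1)).2 h
    rw [map_sub, map_pow, hr4, map_one, sub_eq_zero] at this
    exact hk.2 this
  refine ⟨b ^ 4, hw.mul_left_cancel ?_⟩
  linear_combination h12

/-- A finite local commutative ring with 16 elements, residue field of 4 elements,
and characteristic 4 is isomorphic to `(ZMod 4)[X] ⧸ (X^2 + X + 1)`. -/
theorem stmt2 (R : Type*) [CommRing R] [IsLocalRing R] [Finite R]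
    (hcard : Nat.card R = 16)
    (hres : Nat.card (IsLocalRing.ResidueField R) = 4)
    (hchar : ringChar R = 4) :
    Nonempty (R ≃+* ((ZMod 4)[X] ⧸ Ideal.span {(X : (ZMod 4)[X]) ^ 2 + X + 1})) := by
  classical
  obtain ⟨w, hw⟩ := aux_root_s2 R hcard hres
  have : CharP R 4 := ringChar.of_eq hchar
  let i : ZMod 4 →+* R := ZMod.castHom (dvd_refl 4) R
  have hi : Function.Injective i := ZMod.castHom_injective R
  have key : ∀ a b : ZMod 4, i a * w + i b = 0 → a = 0 ∧ b = 0 := by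
    intro a b h
    have hN : a ^ 2 - a * b + b ^ 2 = 0 := by
      apply hi
      simp only [map_add, map_sub, map_mul, map_pow, map_zero]
      linear_combination (i b - i a - i a * w) * h + i a ^ 2 * hw
    have h2 : i 2 ≠ 0 := fun h0 => by
      have : (2 : ZMod 4) = 0 := hi (by rw [h0, map_zero])
      revert this; decide
    have hc : ∀ a b : ZMod 4, a ^ 2 - a * b + b ^ 2 = 0 →
        (a = 0 ∧ b = 0) ∨ (a = 2 ∧ b = 0) ∨ (a = 0 ∧ b = 2) ∨ (a = 2 ∧ b = 2) := by decide
    rcases hc a b hN with h' | ⟨rfl, rfl⟩ | ⟨rfl, rfl⟩ | ⟨rfl, rfl⟩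
    · exact h'
    · exfalso; apply h2
      rw [map_zero] at h
      linear_combination (-(w + 1)) * h + i 2 * hw
    · exfalso; apply h2
      rw [map_zero] at h
      linear_combination h
    · exfalso; apply h2
      linear_combination (-w) * h + i 2 * hw
  have hinj : Function.Injective (fun p : ZMod 4 × ZMod 4 => i p.1 * w + i p.2) := by
    rintro ⟨a, b⟩ ⟨c, d⟩ h
    simp only at h
    obtain ⟨h1, h2⟩ := key (a - c) (b - d) (by
      rw [map_sub, map_sub]; linear_combination h)
    rw [sub_eq_zero.1 h1, sub_eq_zero.1 h2]
  have hsurj := (Nat.bijective_iff_injective_and_card _).2 ⟨hinj, by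
    rw [hcard, Nat.card_prod, Nat.card_zmod]⟩ |>.2
  let φ : (ZMod 4)[X] →+* R := eval₂RingHom i w
  have hφs : Function.Surjective φ := fun r => by
    obtain ⟨⟨a, b⟩, h⟩ := hsurj r
    exact ⟨C a * X + C b, by simpa [φ] using h⟩
  have hker : RingHom.ker φ = Ideal.span {(X : (ZMod 4)[X]) ^ 2 + X + 1} := by
    have hf0 : φ (X ^ 2 + X + 1) = 0 := by simpa [φ] using hw
    have hdeg : ((X : (ZMod 4)[X]) ^ 2 + X + 1).degree = 2 := by
      have : Nontrivial (ZMod 4) := ⟨0, 1, by decide⟩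
      compute_degree!
    have hm : ((X : (ZMod 4)[X]) ^ 2 + X + 1).Monic := by monicity!
    apply le_antisymm
    · intro p hp
      rw [RingHom.mem_ker] at hp
      rw [Ideal.mem_span_singleton, ← modByMonic_eq_zero_iff_dvd hm]
      have : Nontrivial (ZMod 4) := ⟨0, 1, by decide⟩
      have hd : (p %ₘ (X ^ 2 + X + 1)).degree < 2 := hdeg ▸ degree_modByMonic_lt p hm
      have hp' : φ (p %ₘ (X ^ 2 + X + 1)) = 0 := by
        have := congrArg φ (modByMonic_add_div p (X ^ 2 + X + 1))
        rw [map_add, map_mul, hf0, hp] at this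
        simpa using this
      have hl := eq_X_add_C_of_degree_le_one (p := p %ₘ (X ^ 2 + X + 1))
        (Order.le_of_lt_succ hd)
      generalize p %ₘ (X ^ 2 + X + 1) = q at *
      rw [hl] at hp'
      obtain ⟨h1, h2⟩ := key (q.coeff 1) (q.coeff 0) (by simpa [φ] using hp')
      rw [hl, h1, h2]; simp
    · rw [Ideal.span_singleton_le_iff_mem]
      exact hf0
  exact ⟨((Ideal.quotEquivOfEq hker.symm).trans
    (RingHom.quotientKerEquivOfSurjective hφs)).symm⟩
end

section
/- Let (R, m) be a finite local commutative ring with |R| = p^n, where p is a prime and n is a positive integer. If m^(n-1) ≠ 0, then the maximal ideal m is a principal ideal. -/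
/-- If `(R, m)` is a finite local commutative ring with `|R| = p^n` (`p` prime,
`n ≥ 1`) and `m^(n-1) ≠ 0`, then the maximal ideal `m` is principal. -/
theorem stmt3 (p n : ℕ) (hp : p.Prime) (hn : 0 < n)
    (R : Type*) [CommRing R] [IsLocalRing R] [Finite R]
    (hcard : Nat.card R = p ^ n)
    (hm : IsLocalRing.maximalIdeal R ^ (n - 1) ≠ ⊥) :
    (IsLocalRing.maximalIdeal R).IsPrincipal := by
  set m := IsLocalRing.maximalIdeal R with hmdef
  have h1 : ∀ I : Ideal R, ∃ e, Nat.card I = p ^ e := by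
    intro I
    have hd : Nat.card I ∣ p ^ n := hcard ▸ AddSubgroup.card_addSubgroup_dvd_card I.toAddSubgroup
    obtain ⟨e, _, he⟩ := (Nat.dvd_prime_pow hp).1 hd
    exact ⟨e, he⟩
  choose e he using h1
  have mono : ∀ I J : Ideal R, I < J → e I < e J := by
    intro I J h
    have hc : Nat.card I < Nat.card J :=
      Set.ncard_lt_ncard (s := (I : Set R)) (t := (J : Set R)) (SetLike.coe_ssubset_coe.2 h)
        (Set.toFinite _)
    rw [he, he] at hc
    exact (Nat.pow_lt_pow_iff_right hp.one_lt).1 hc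
  have htop : e ⊤ = n := by
    apply Nat.pow_right_injective hp.two_le
    show p ^ e ⊤ = p ^ n
    rw [← he, ← hcard]
    exact Nat.card_congr (Equiv.Set.univ R)
  have hjac : m ≤ Ideal.jacobson ⊥ := (IsLocalRing.jacobson_eq_maximalIdeal ⊥ bot_ne_top).ge
  have step : ∀ i, m ^ i ≠ ⊥ → m ^ (i + 1) < m ^ i := by
    intro i hi
    refine lt_of_le_of_ne (Ideal.pow_le_pow_right (Nat.le_succ i)) fun h => hi ?_
    refine Submodule.eq_bot_of_le_smul_of_le_jacobson_bot m (m ^ i) (IsNoetherian.noetherian _) ?_ hjac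
    rw [smul_eq_mul, ← pow_succ', h]
  have hne : ∀ i, i ≤ n - 1 → m ^ i ≠ ⊥ := by
    intro i hi h
    exact hm (le_bot_iff.1 (h ▸ Ideal.pow_le_pow_right hi))
  have low : ∀ j, j ≤ n - 1 → j + 1 ≤ e (m ^ (n - 1 - j)) := by
    intro j
    induction j with
    | zero =>
      intro _
      have := mono ⊥ (m ^ (n - 1)) (bot_lt_iff_ne_bot.2 hm)
      simp only [Nat.sub_zero]
      omega
    | succ j ih =>
      intro hj
      have a := ih (by omega)
      have b := mono _ _ (step (n - 1 - (j + 1)) (hne _ (by omega)))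
      rw [show n - 1 - (j + 1) + 1 = n - 1 - j by omega] at b
      omega
  by_cases hb : m = ⊥
  · rw [hb]; infer_instance
  have e1 : e m < n := htop ▸ mono m ⊤ (lt_top_iff_ne_top.2 (IsLocalRing.maximalIdeal.isMaximal R).ne_top)
  have e2 : n ≤ e (m ^ 2) + 2 := by
    by_cases h : 3 ≤ n
    · have := low (n - 3) (by omega)
      rw [show n - 1 - (n - 3) = 2 by omega] at this
      omega
    · omega
  have hlt : m ^ 2 < m := by simpa using step 1 (by simpa using hb)
  obtain ⟨x, hx, hx2⟩ := SetLike.exists_of_lt hlt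
  have hxm : Ideal.span {x} ≤ m := (Ideal.span_singleton_le_iff_mem _).2 hx
  have hJ : Ideal.span {x} ⊔ m ^ 2 = m := by
    by_contra h
    have a := mono _ _ (lt_of_le_of_ne (sup_le hxm hlt.le) h)
    have b : m ^ 2 < Ideal.span {x} ⊔ m ^ 2 := by
      refine lt_of_le_of_ne le_sup_right fun h' => hx2 ?_
      rw [h']
      exact Ideal.mem_sup_left (Ideal.mem_span_singleton_self x)
    have := mono _ _ b
    omega
  have : m ≤ Ideal.span {x} := by
    refine Submodule.le_of_le_smul_of_le_jacobson_bot (I := m) (IsNoetherian.noetherian m) hjac ?_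
    rw [smul_eq_mul, ← pow_two, hJ]
  exact ⟨⟨x, le_antisymm this hxm⟩⟩
end

section
/- Let (R, m) be a finite local commutative ring with |R| = p^n, where p is a prime and n is a positive integer, and suppose m^(n-1) ≠ 0. Then the zero-divisor graph Γ(R) is isomorphic as a simple graph to the zero-divisor graph Γ(Z/p^n Z). -/
/-- The zero-divisor graph of a commutative ring: vertices are the nonzero zero-divisors,
with distinct vertices adjacent iff their product is zero. -/
def zeroDivisorGraph (R : Type*) [CommRing R] :
    SimpleGraph {x : R // x ≠ 0 ∧ ∃ y : R, y ≠ 0 ∧ x * y = 0} where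
  Adj u v := u ≠ v ∧ u.1 * v.1 = 0
  symm := ⟨fun u v h => ⟨h.1.symm, by rw [mul_comm]; exact h.2⟩⟩
  loopless := ⟨fun u h => h.1 rfl⟩

theorem aux_val (p n : ℕ) (hp : p.Prime) (hn : 0 < n)
    (R : Type*) [CommRing R] [IsLocalRing R] [Finite R]
    (hcard : Nat.card R = p ^ n)
    (hm : IsLocalRing.maximalIdeal R ^ (n - 1) ≠ ⊥) :
    ∃ ν : R → ℕ, (∀ i, {x | i ≤ ν x}.ncard = if i ≤ n then p ^ (n - i) else 0) ∧
      (∀ x, x = 0 ↔ n ≤ ν x) ∧ (∀ x y, x * y = 0 ↔ n ≤ ν x + ν y) := by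
  classical
  set m := IsLocalRing.maximalIdeal R with hmdef
  have hJ : m ≤ Ideal.jacobson ⊥ := (IsLocalRing.jacobson_eq_maximalIdeal ⊥ bot_ne_top).ge
  have hpow : ∀ I : Ideal R, ∃ k, Nat.card I = p ^ k := by
    intro I
    have h : Nat.card I ∣ Nat.card R := AddSubgroup.card_addSubgroup_dvd_card I.toAddSubgroup
    rw [hcard, Nat.dvd_prime_pow hp] at h
    obtain ⟨k, -, h⟩ := h
    exact ⟨k, h⟩
  choose a ha using hpow
  have hlt : ∀ I J : Ideal R, I < J → a I < a J := by
    intro I J hIJ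
    have h : Nat.card I < Nat.card J :=
      Set.ncard_lt_ncard (SetLike.coe_ssubset_coe.mpr hIJ) (Set.toFinite _)
    rw [ha, ha] at h
    exact (Nat.pow_lt_pow_iff_right hp.one_lt).mp h
  have heq : ∀ I J : Ideal R, I ≤ J → a J ≤ a I → I = J := by
    intro I J h h2
    by_contra hne
    exact absurd (hlt I J (lt_of_le_of_ne h hne)) (by omega)
  have hstep : ∀ i, m ^ i ≠ ⊥ → m ^ (i+1) < m ^ i := by
    intro i hi
    refine lt_of_le_of_ne (Ideal.pow_le_pow_right (Nat.le_succ i)) fun h => hi ?_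
    refine Submodule.eq_bot_of_le_smul_of_le_jacobson_bot m (m ^ i) (IsNoetherian.noetherian _) ?_ hJ
    rw [smul_eq_mul, ← pow_succ', h]
  have hne : ∀ i < n, m ^ i ≠ ⊥ := by
    intro i hi h
    exact hm (le_bot_iff.mp (h ▸ Ideal.pow_le_pow_right (by omega)))
  have hstepa : ∀ i < n, a (m ^ (i+1)) < a (m ^ i) := fun i hi => hlt _ _ (hstep i (hne i hi))
  have ha0 : a (m ^ 0) = n := by
    have h := ha (m ^ 0)
    have h2 : Nat.card ((m ^ 0 : Ideal R)) = Nat.card R := by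
      rw [pow_zero, Ideal.one_eq_top]
      exact Nat.card_congr (Equiv.Set.univ R)
    rw [h2, hcard] at h
    exact (Nat.pow_right_injective hp.two_le h).symm
  have hup : ∀ i ≤ n, a (m ^ i) + i ≤ n := by
    intro i
    induction i with
    | zero => intro _; omega
    | succ k ih => intro h; have := ih (by omega); have := hstepa k (by omega); omega
  have hdown : ∀ k i, i + k = n → k ≤ a (m ^ i) := by
    intro k
    induction k with
    | zero => intros; omega
    | succ k ih => intro i h; have := ih (i+1) (by omega); have := hstepa i (by omega); omega
  have hai : ∀ i ≤ n, a (m ^ i) = n - i := by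
    intro i hi
    have := hup i hi
    have := hdown (n - i) i (by omega)
    omega
  have hbot : m ^ n = ⊥ := by
    refine (heq ⊥ (m ^ n) bot_le ?_).symm
    rw [hai n le_rfl]; omega
  have hgen : ∀ i < n, ∀ x ∈ m ^ i, x ∉ m ^ (i+1) → Ideal.span {x} = m ^ i := by
    intro i hi x hx hx'
    have h1 : Ideal.span {x} ≤ m ^ i := (Ideal.span_singleton_le_iff_mem _).mpr hx
    have h2 : m ^ (i+1) < Ideal.span {x} ⊔ m ^ (i+1) := by
      refine lt_of_le_of_ne le_sup_right fun h => hx' ?_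
      rw [h]
      exact Ideal.mem_sup_left (Ideal.mem_span_singleton_self x)
    have h3 : Ideal.span {x} ⊔ m ^ (i+1) = m ^ i := by
      refine heq _ _ (sup_le h1 (Ideal.pow_le_pow_right (Nat.le_succ i))) ?_
      have := hlt _ _ h2
      rw [hai _ (by omega)] at this ⊢
      omega
    refine le_antisymm h1 ?_
    refine Submodule.le_of_le_smul_of_le_jacobson_bot (I := m) (IsNoetherian.noetherian _) hJ ?_
    rw [smul_eq_mul, ← pow_succ', h3]
  let ν : R → ℕ := fun x => Nat.findGreatest (fun i => x ∈ m ^ i) n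
  have hν1 : ∀ x, x ∈ m ^ (ν x) := fun x =>
    Nat.findGreatest_spec (P := fun i => x ∈ m ^ i) (Nat.zero_le n) (by simp)
  have hνn : ∀ x, ν x ≤ n := fun x => Nat.findGreatest_le n
  have hν2 : ∀ x i, i ≤ n → (i ≤ ν x ↔ x ∈ m ^ i) := by
    intro x i hi
    exact ⟨fun h => Ideal.pow_le_pow_right h (hν1 x),
      fun h => Nat.le_findGreatest (P := fun i => x ∈ m ^ i) hi h⟩
  have hz : ∀ x, x = 0 ↔ n ≤ ν x := by
    intro x
    rw [hν2 x n le_rfl, hbot, Ideal.mem_bot]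
  refine ⟨ν, ?_, hz, ?_⟩
  · intro i
    split_ifs with hi
    · have : {x | i ≤ ν x} = ((m ^ i : Ideal R) : Set R) := by
        ext x; exact hν2 x i hi
      rw [this, ← hai i hi, ← ha]
      rfl
    · have : {x | i ≤ ν x} = ∅ := by
        ext x
        have := hνn x
        simp only [Set.mem_ofPred_eq, Set.mem_empty_iff_false, iff_false]
        omega
      rw [this, Set.ncard_empty]
  · intro x y
    by_cases hx : n ≤ ν x
    · rw [(hz x).mpr hx, zero_mul]
      have := (hz 0).mp rfl
      simp only [true_iff]; omega
    by_cases hy : n ≤ ν y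
    · rw [(hz y).mpr hy, mul_zero]
      have := (hz 0).mp rfl
      simp only [true_iff]; omega
    have gx := hgen (ν x) (by omega) x (hν1 x) (by rw [← hν2 x _ (by omega)]; omega)
    have gy := hgen (ν y) (by omega) y (hν1 y) (by rw [← hν2 y _ (by omega)]; omega)
    have : Ideal.span {x * y} = m ^ (ν x + ν y) := by
      rw [pow_add, ← gx, ← gy, Ideal.span_singleton_mul_span_singleton]
    rw [← Ideal.span_singleton_eq_bot, this]
    constructor
    · intro h
      by_contra hlt'
      exact hne _ (by omega) h
    · intro h
      exact le_bot_iff.mp (hbot ▸ Ideal.pow_le_pow_right h)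

theorem aux_key {T : Type*} [Finite T] (f : T → ℕ) (i : ℕ) :
    Nat.card {x // f x = i} = {x | i ≤ f x}.ncard - {x | i + 1 ≤ f x}.ncard := by
  have hs : {x | i + 1 ≤ f x} ⊆ {x | i ≤ f x} := fun x hx => Nat.le_of_succ_le hx
  rw [← Set.ncard_sdiff hs (Set.toFinite _)]
  change Set.ncard {x | f x = i} = _
  congr 1
  ext x
  simp only [Set.mem_ofPred_eq, Set.mem_sdiff]
  omega

theorem aux_fiber {R S : Type*} [Finite R] [Finite S] (ν : R → ℕ) (μ : S → ℕ)
    (h : ∀ i, {x | i ≤ ν x}.ncard = {x | i ≤ μ x}.ncard) :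
    ∃ e : R ≃ S, ∀ x, μ (e x) = ν x := by
  have hc : ∀ i, Nonempty ({x // ν x = i} ≃ {x // μ x = i}) := by
    intro i
    apply Finite.card_eq.mp
    rw [aux_key ν, aux_key μ, h, h]
  let E := fun i => (hc i).some
  refine ⟨(Equiv.sigmaFiberEquiv ν).symm.trans
    ((Equiv.sigmaCongrRight E).trans (Equiv.sigmaFiberEquiv μ)), fun x => ?_⟩
  exact (E (ν x) ⟨x, rfl⟩).2

/-- If `(R, m)` is a finite local commutative ring with `|R| = p^n` (`p` prime,
`n ≥ 1`) and `m^(n-1) ≠ 0`, then `Γ(R)` is isomorphic to `Γ(ZMod (p^n))`. -/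
theorem stmt4 (p n : ℕ) (hp : p.Prime) (hn : 0 < n)
    (R : Type*) [CommRing R] [IsLocalRing R] [Finite R]
    (hcard : Nat.card R = p ^ n)
    (hm : IsLocalRing.maximalIdeal R ^ (n - 1) ≠ ⊥) :
    Nonempty (zeroDivisorGraph R ≃g zeroDivisorGraph (ZMod (p ^ n))) := by
  have : Fact p.Prime := ⟨hp⟩
  have : NeZero (p ^ n) := ⟨(pow_pos hp.pos n).ne'⟩
  have : Fact (1 < p ^ n) := ⟨Nat.one_lt_pow hn.ne' hp.one_lt⟩
  have : IsLocalRing (ZMod (p ^ n)) :=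
    IsLocalRing.of_surjective' (PadicInt.toZModPow n : ℤ_[p] →+* ZMod (p ^ n))
      (ZMod.ringHom_surjective _)
  have hm' : IsLocalRing.maximalIdeal (ZMod (p ^ n)) ^ (n - 1) ≠ ⊥ := by
    intro h
    have h1 : (p : ZMod (p ^ n)) ∈ IsLocalRing.maximalIdeal (ZMod (p ^ n)) := by
      rw [IsLocalRing.mem_maximalIdeal, mem_nonunits_iff]
      intro hu
      have h2 := hu.pow n
      rw [← Nat.cast_pow, ZMod.natCast_self] at h2
      exact not_isUnit_zero h2
    have h2 := Ideal.pow_mem_pow h1 (n - 1)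
    rw [h, Ideal.mem_bot, ← Nat.cast_pow, ZMod.natCast_eq_zero_iff,
      Nat.pow_dvd_pow_iff_le_right hp.one_lt] at h2
    omega
  obtain ⟨ν, hν, hν0, hνm⟩ := aux_val p n hp hn R hcard hm
  obtain ⟨μ, hμ, hμ0, hμm⟩ := aux_val p n hp hn (ZMod (p ^ n)) (Nat.card_zmod _) hm'
  obtain ⟨e, he⟩ := aux_fiber ν μ (fun i => by rw [hν, hμ])
  have e0 : ∀ x, e x = 0 ↔ x = 0 := fun x => by rw [hμ0, hν0, he]
  have em : ∀ x y, e x * e y = 0 ↔ x * y = 0 := fun x y => by rw [hμm, hνm, he, he]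
  refine ⟨⟨e.subtypeEquiv fun x => ?_, fun {u v} => ?_⟩⟩
  · refine and_congr (not_congr (e0 x).symm) ?_
    constructor
    · rintro ⟨y, hy, h⟩
      exact ⟨e y, (e0 y).not.mpr hy, (em x y).mpr h⟩
    · rintro ⟨y, hy, h⟩
      obtain ⟨z, rfl⟩ := e.surjective y
      exact ⟨z, (e0 z).not.mp hy, (em x z).mp h⟩
  · exact and_congr ((Equiv.injective _).ne_iff) (em u.1 v.1)
end

section
/- The zero-divisor graph of the ring (Z/2Z)[x,y]/(x^3, xy, y^2) is isomorphic as a simple graph to the complete 4-partite graph K_{1,1,1,4}, i.e., the complete multipartite graph with parts of sizes 1, 1, 1, and 4. -/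
open MvPolynomial

/-- The concrete model: `(a,b,c,d)` stands for `a + b x + c x^2 + d y`. -/
@[ext] structure TT where
  a : ZMod 2
  b : ZMod 2
  c : ZMod 2
  d : ZMod 2

namespace TT

def eqv : TT ≃ ZMod 2 × ZMod 2 × ZMod 2 × ZMod 2 where
  toFun t := (t.a, t.b, t.c, t.d)
  invFun p := ⟨p.1, p.2.1, p.2.2.1, p.2.2.2⟩
  left_inv _ := rfl
  right_inv _ := rfl

instance : DecidableEq TT := eqv.decidableEq
instance : Fintype TT := Fintype.ofEquiv _ eqv.symm

instance : Zero TT := ⟨⟨0, 0, 0, 0⟩⟩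
instance : One TT := ⟨⟨1, 0, 0, 0⟩⟩
instance : Add TT := ⟨fun s t => ⟨s.a + t.a, s.b + t.b, s.c + t.c, s.d + t.d⟩⟩
instance : Neg TT := ⟨fun s => ⟨-s.a, -s.b, -s.c, -s.d⟩⟩
instance : Mul TT := ⟨fun s t => ⟨s.a * t.a, s.a * t.b + s.b * t.a,
  s.a * t.c + s.b * t.b + s.c * t.a, s.a * t.d + s.d * t.a⟩⟩

theorem zero_def : (0 : TT) = ⟨0, 0, 0, 0⟩ := rfl
theorem one_def : (1 : TT) = ⟨1, 0, 0, 0⟩ := rfl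
theorem add_def (s t : TT) : s + t = ⟨s.a + t.a, s.b + t.b, s.c + t.c, s.d + t.d⟩ := rfl
theorem neg_def (s : TT) : -s = ⟨-s.a, -s.b, -s.c, -s.d⟩ := rfl
theorem mul_def (s t : TT) : s * t = ⟨s.a * t.a, s.a * t.b + s.b * t.a,
  s.a * t.c + s.b * t.b + s.c * t.a, s.a * t.d + s.d * t.a⟩ := rfl

instance : CommRing TT where
  add_assoc r s t := by simp only [add_def]; ext <;> ring
  zero_add r := by simp only [add_def, zero_def]; ext <;> ring
  add_zero r := by simp only [add_def, zero_def]; ext <;> ring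
  add_comm r s := by simp only [add_def]; ext <;> ring
  neg_add_cancel r := by simp only [add_def, neg_def, zero_def]; ext <;> ring
  mul_assoc r s t := by simp only [mul_def]; ext <;> ring
  one_mul r := by simp only [mul_def, one_def]; ext <;> ring
  mul_one r := by simp only [mul_def, one_def]; ext <;> ring
  mul_comm r s := by simp only [mul_def]; ext <;> ring
  left_distrib r s t := by simp only [mul_def, add_def]; ext <;> ring
  right_distrib r s t := by simp only [mul_def, add_def]; ext <;> ring
  zero_mul r := by simp only [mul_def, zero_def]; ext <;> ring
  mul_zero r := by simp only [mul_def, zero_def]; ext <;> ring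
  nsmul := nsmulRec
  zsmul := zsmulRec

def cst : ZMod 2 →+* TT where
  toFun a := ⟨a, 0, 0, 0⟩
  map_zero' := rfl
  map_one' := rfl
  map_add' := by decide
  map_mul' := by decide

end TT

noncomputable abbrev II : Ideal (MvPolynomial (Fin 2) (ZMod 2)) :=
  Ideal.span {(X 0 : MvPolynomial (Fin 2) (ZMod 2)) ^ 3, X 0 * X 1,
    (X 1 : MvPolynomial (Fin 2) (ZMod 2)) ^ 2}

noncomputable def phi0 : MvPolynomial (Fin 2) (ZMod 2) →+* TT :=
  eval₂Hom TT.cst ![⟨0, 1, 0, 0⟩, ⟨0, 0, 0, 1⟩]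

theorem phi0_X0 : phi0 (X 0) = ⟨0, 1, 0, 0⟩ := by simp [phi0]
theorem phi0_X1 : phi0 (X 1) = ⟨0, 0, 0, 1⟩ := by simp [phi0]
theorem phi0_C (a : ZMod 2) : phi0 (C a) = ⟨a, 0, 0, 0⟩ := by
  simp only [phi0, coe_eval₂Hom, eval₂_C]; rfl

theorem phi0_II : ∀ p ∈ II, phi0 p = 0 := by
  intro p hp
  have : II ≤ RingHom.ker phi0 := by
    rw [Ideal.span_le]
    rintro q (rfl | rfl | rfl) <;>
      simp only [SetLike.mem_coe, RingHom.mem_ker, map_pow, map_mul, phi0_X0, phi0_X1] <;> decide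
  exact this hp

noncomputable def phi : MvPolynomial (Fin 2) (ZMod 2) ⧸ II →+* TT :=
  Ideal.Quotient.lift II phi0 phi0_II

noncomputable def gg (t : TT) : MvPolynomial (Fin 2) (ZMod 2) :=
  C t.a + C t.b * X 0 + C t.c * X 0 ^ 2 + C t.d * X 1

theorem phi0_gg (t : TT) : phi0 (gg t) = t := by
  simp only [gg, map_add, map_mul, map_pow, phi0_X0, phi0_X1, phi0_C]
  revert t; decide

theorem gg_surj (p : MvPolynomial (Fin 2) (ZMod 2)) :
    ∃ t, Ideal.Quotient.mk II p = Ideal.Quotient.mk II (gg t) := by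
  have h1 : Ideal.Quotient.mk II (X 0) ^ 3 = 0 := by
    rw [← map_pow]; exact Ideal.Quotient.eq_zero_iff_mem.2 (Ideal.subset_span (by simp))
  have h2 : Ideal.Quotient.mk II (X 0) * Ideal.Quotient.mk II (X 1) = 0 := by
    rw [← map_mul]; exact Ideal.Quotient.eq_zero_iff_mem.2 (Ideal.subset_span (by simp))
  have h3 : Ideal.Quotient.mk II (X 1) ^ 2 = 0 := by
    rw [← map_pow]; exact Ideal.Quotient.eq_zero_iff_mem.2 (Ideal.subset_span (by simp))
  induction p using MvPolynomial.induction_on with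
  | C a => exact ⟨⟨a, 0, 0, 0⟩, by simp [gg]⟩
  | add p q hp hq =>
    obtain ⟨s, hs⟩ := hp
    obtain ⟨t, ht⟩ := hq
    refine ⟨s + t, ?_⟩
    rw [map_add, hs, ht, ← map_add]
    congr 1
    simp only [gg, TT.add_def, C_add]
    ring
  | mul_X p i hp =>
    obtain ⟨s, hs⟩ := hp
    rw [map_mul, hs]
    fin_cases i
    · refine ⟨⟨0, s.a, s.b, 0⟩, ?_⟩
      simp only [gg, map_add, map_mul, map_pow, map_zero, Fin.zero_eta]
      linear_combination (Ideal.Quotient.mk II (C s.c)) * h1 + (Ideal.Quotient.mk II (C s.d)) * h2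
    · refine ⟨⟨0, 0, 0, s.a⟩, ?_⟩
      simp only [gg, map_add, map_mul, map_pow, map_zero, Fin.mk_one]
      linear_combination (Ideal.Quotient.mk II (C s.b)) * h2 + (Ideal.Quotient.mk II (C s.d)) * h3
        + (Ideal.Quotient.mk II (C s.c)) * Ideal.Quotient.mk II (X 0) * h2

theorem phi_bij : Function.Bijective phi := by
  have key : ∀ t, phi (Ideal.Quotient.mk II (gg t)) = t := fun t => by
    simp only [phi, Ideal.Quotient.lift_mk, phi0_gg]
  refine ⟨fun u v h => ?_, fun t => ⟨_, key t⟩⟩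
  obtain ⟨p, rfl⟩ := Ideal.Quotient.mk_surjective u
  obtain ⟨q, rfl⟩ := Ideal.Quotient.mk_surjective v
  obtain ⟨s, hs⟩ := gg_surj p
  obtain ⟨t, ht⟩ := gg_surj q
  rw [hs, ht, key, key] at h
  rw [hs, ht, h]

def zdIso {R S : Type*} [CommRing R] [CommRing S] (e : R ≃+* S) :
    zeroDivisorGraph R ≃g zeroDivisorGraph S where
  toEquiv := e.toEquiv.subtypeEquiv (by
    intro x
    refine and_congr (by simp [map_eq_zero_iff e e.injective]) ⟨?_, ?_⟩
    · rintro ⟨y, hy, h⟩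
      exact ⟨e y, by simpa using hy, by
        have := congrArg e h
        simpa using this⟩
    · rintro ⟨y, hy, h⟩
      exact ⟨e.symm y, by simpa using hy, by
        have := congrArg e.symm h
        simpa using this⟩)
  map_rel_iff' := by
    intro u v
    refine and_congr (by simp [Subtype.ext_iff]) ?_
    change e u.1 * e v.1 = 0 ↔ _
    rw [← map_mul, map_eq_zero_iff e e.injective]

abbrev VV := {x : TT // x ≠ 0 ∧ ∃ y : TT, y ≠ 0 ∧ x * y = 0}

def toSig (t : TT) : (i : Fin 4) × (![Fin 1, Fin 1, Fin 1, Fin 4] i) :=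
  if t.b = 1 then ⟨3, (if t.c = 0 then (if t.d = 0 then 0 else 1)
    else (if t.d = 0 then 2 else 3) : Fin 4)⟩
  else if t.c = 0 then ⟨0, (0 : Fin 1)⟩
  else if t.d = 0 then ⟨1, (0 : Fin 1)⟩ else ⟨2, (0 : Fin 1)⟩

theorem vv_cases : ∀ t : TT, (t ≠ 0 ∧ ∃ y : TT, y ≠ 0 ∧ t * y = 0) ↔ t ∈ ([⟨0,0,0,1⟩, ⟨0,0,1,0⟩,
    ⟨0,0,1,1⟩, ⟨0,1,0,0⟩, ⟨0,1,0,1⟩, ⟨0,1,1,0⟩, ⟨0,1,1,1⟩] : List TT) := by decide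

def fromSig : (i : Fin 4) × (![Fin 1, Fin 1, Fin 1, Fin 4] i) → TT
  | ⟨0, _⟩ => ⟨0,0,0,1⟩
  | ⟨1, _⟩ => ⟨0,0,1,0⟩
  | ⟨2, _⟩ => ⟨0,0,1,1⟩
  | ⟨3, k⟩ => (![⟨0,1,0,0⟩, ⟨0,1,0,1⟩, ⟨0,1,1,0⟩, ⟨0,1,1,1⟩] : Fin 4 → TT) k

theorem sig_cases {P : (i : Fin 4) × (![Fin 1, Fin 1, Fin 1, Fin 4] i) → Prop}
    (h0 : P ⟨0, (0 : Fin 1)⟩) (h1 : P ⟨1, (0 : Fin 1)⟩) (h2 : P ⟨2, (0 : Fin 1)⟩)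
    (h3 : ∀ k : Fin 4, P ⟨3, k⟩) : ∀ s, P s
  | ⟨0, k⟩ => by
    have : k = (0 : Fin 1) := Subsingleton.elim (α := Fin 1) _ _
    subst this; exact h0
  | ⟨1, k⟩ => by
    have : k = (0 : Fin 1) := Subsingleton.elim (α := Fin 1) _ _
    subst this; exact h1
  | ⟨2, k⟩ => by
    have : k = (0 : Fin 1) := Subsingleton.elim (α := Fin 1) _ _
    subst this; exact h2
  | ⟨3, k⟩ => h3 k

def sigEquiv : VV ≃ (i : Fin 4) × (![Fin 1, Fin 1, Fin 1, Fin 4] i) where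
  toFun t := toSig t.1
  invFun s := ⟨fromSig s, by
    rw [vv_cases]
    revert s
    refine sig_cases ?_ ?_ ?_ ?_
    · decide
    · decide
    · decide
    · intro k; revert k; decide⟩
  left_inv := by
    rintro ⟨t, ht⟩
    apply Subtype.ext
    change fromSig (toSig t) = t
    have h := (vv_cases t).1 ht
    revert h
    clear ht
    revert t
    decide
  right_inv := by
    refine sig_cases ?_ ?_ ?_ ?_
    · rfl
    · rfl
    · rfl
    · intro k; fin_cases k <;> rfl

theorem adj_key : ∀ s : TT, s ∈ ([⟨0,0,0,1⟩, ⟨0,0,1,0⟩,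
    ⟨0,0,1,1⟩, ⟨0,1,0,0⟩, ⟨0,1,0,1⟩, ⟨0,1,1,0⟩, ⟨0,1,1,1⟩] : List TT) →
    ∀ t : TT, t ∈ ([⟨0,0,0,1⟩, ⟨0,0,1,0⟩,
    ⟨0,0,1,1⟩, ⟨0,1,0,0⟩, ⟨0,1,0,1⟩, ⟨0,1,1,0⟩, ⟨0,1,1,1⟩] : List TT) →
    ((toSig s).1 ≠ (toSig t).1 ↔ (s ≠ t ∧ s * t = 0)) := by decide

def ttIso : zeroDivisorGraph TT ≃g
    SimpleGraph.completeMultipartiteGraph ![Fin 1, Fin 1, Fin 1, Fin 4] where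
  toEquiv := sigEquiv
  map_rel_iff' := by
    rintro ⟨s, hs⟩ ⟨t, ht⟩
    refine (adj_key s ((vv_cases s).1 hs) t ((vv_cases t).1 ht)).trans ?_
    exact and_congr (by simp) Iff.rfl

/-- `Γ((ZMod 2)[x,y]/(x^3, xy, y^2))` is isomorphic to the complete
multipartite graph `K_{1,1,1,4}`. -/
theorem stmt6 :
    Nonempty (zeroDivisorGraph
      (MvPolynomial (Fin 2) (ZMod 2) ⧸
        Ideal.span {(X 0 : MvPolynomial (Fin 2) (ZMod 2)) ^ 3, X 0 * X 1, (X 1 : MvPolynomial (Fin 2) (ZMod 2)) ^ 2}) ≃g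
      SimpleGraph.completeMultipartiteGraph ![Fin 1, Fin 1, Fin 1, Fin 4]) := by
  exact ⟨(zdIso (RingEquiv.ofBijective phi phi_bij)).trans ttIso⟩
end

section
/- The zero-divisor graph of the ring (Z/4Z)[x]/(x^3, 2x) is isomorphic as a simple graph to the complete 4-partite graph K_{1,1,1,4}, i.e., the complete multipartite graph with parts of sizes 1, 1, 1, and 4. -/
open Polynomial

def TT_s7 : Type := ZMod 4 × ZMod 2 × ZMod 2

namespace TT_s7

instance : AddCommGroup TT_s7 := inferInstanceAs (AddCommGroup (ZMod 4 × ZMod 2 × ZMod 2))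
instance inst_s7 : DecidableEq TT_s7 := inferInstanceAs (DecidableEq (ZMod 4 × ZMod 2 × ZMod 2))
instance inst_s7_2 : Fintype TT_s7 := inferInstanceAs (Fintype (ZMod 4 × ZMod 2 × ZMod 2))

def red : ZMod 4 →+* ZMod 2 := ZMod.castHom (by norm_num) (ZMod 2)

instance inst_s7_3 : Mul TT_s7 := ⟨fun s t => (s.1 * t.1, red s.1 * t.2.1 + red t.1 * s.2.1,
  red s.1 * t.2.2 + s.2.1 * t.2.1 + red t.1 * s.2.2)⟩
instance inst_s7_4 : One TT_s7 := ⟨((1 : ZMod 4), (0 : ZMod 2), (0 : ZMod 2))⟩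

theorem ext' {s t : TT_s7} (h1 : s.1 = t.1) (h2 : s.2.1 = t.2.1) (h3 : s.2.2 = t.2.2) : s = t :=
  Prod.ext h1 (Prod.ext h2 h3)

theorem mul1 (s t : TT_s7) : (s * t).1 = s.1 * t.1 := rfl
theorem mul2 (s t : TT_s7) : (s * t).2.1 = red s.1 * t.2.1 + red t.1 * s.2.1 := rfl
theorem mul3 (s t : TT_s7) :
  (s * t).2.2 = red s.1 * t.2.2 + s.2.1 * t.2.1 + red t.1 * s.2.2 := rfl
theorem add1 (s t : TT_s7) : (s + t).1 = s.1 + t.1 := rfl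
theorem add2 (s t : TT_s7) : (s + t).2.1 = s.2.1 + t.2.1 := rfl
theorem add3 (s t : TT_s7) : (s + t).2.2 = s.2.2 + t.2.2 := rfl

theorem mul_comm' (s t : TT_s7) : s * t = t * s := by
  apply ext' <;> simp only [mul1, mul2, mul3] <;> ring
theorem one_mul' (s : TT_s7) : 1 * s = s := by revert s; decide
theorem zero_mul' (s : TT_s7) : 0 * s = 0 := by revert s; decide
theorem mul_assoc' (s t u : TT_s7) : s * t * u = s * (t * u) := by
  apply ext' <;> simp only [mul1, mul2, mul3, map_mul] <;> ring
theorem mul_add' (s t u : TT_s7) : s * (t + u) = s * t + s * u := by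
  apply ext' <;> simp only [mul1, mul2, mul3, add1, add2, add3, map_add] <;> ring

instance inst_s7_5 : CommRing TT_s7 :=
  { (inferInstance : AddCommGroup TT_s7) with
    mul := (· * ·)
    one := 1
    mul_assoc := mul_assoc'
    mul_comm := mul_comm'
    one_mul := one_mul'
    mul_one := fun s => by rw [mul_comm', one_mul']
    zero_mul := zero_mul'
    mul_zero := fun s => by rw [mul_comm', zero_mul']
    left_distrib := mul_add'
    right_distrib := fun s t u => by
      rw [mul_comm', mul_add', mul_comm' u s, mul_comm' u t] }

def mk (a : ZMod 4) (b c : ZMod 2) : TT_s7 := (a, b, c)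

def ι : ZMod 4 →+* TT_s7 where
  toFun a := mk a 0 0
  map_one' := rfl
  map_zero' := rfl
  map_mul' := by decide
  map_add' := by decide

noncomputable abbrev I : Ideal (ZMod 4)[X] :=
  Ideal.span {(X : (ZMod 4)[X]) ^ 3, 2 * (X : (ZMod 4)[X])}

noncomputable def ev : (ZMod 4)[X] →+* TT_s7 := eval₂RingHom ι (mk 0 1 0)

theorem ev_X : ev X = mk 0 1 0 := by simp [ev]
theorem ev_C (a : ZMod 4) : ev (C a) = ι a := by simp [ev]

theorem I_X3 : (X : (ZMod 4)[X]) ^ 3 ∈ I := Ideal.subset_span (by simp)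
theorem I_2X : 2 * (X : (ZMod 4)[X]) ∈ I := Ideal.subset_span (by simp)

theorem I_le (p : (ZMod 4)[X]) (hp : p ∈ I) : ev p = 0 := by
  have : I ≤ RingHom.ker ev := by
    rw [Ideal.span_le]
    rintro q (rfl | rfl)
    · rw [SetLike.mem_coe, RingHom.mem_ker, map_pow, ev_X]; decide
    · rw [SetLike.mem_coe, RingHom.mem_ker, map_mul, ev_X, map_ofNat]
      rw [two_mul]; decide
  exact this hp

theorem ker_le (p : (ZMod 4)[X]) (hp : ev p = 0) : p ∈ I := by
  obtain ⟨a, p1, rfl⟩ : ∃ a p1, p = p1 * X + C a := ⟨_, _, (divX_mul_X_add p).symm⟩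
  obtain ⟨b, p2, rfl⟩ : ∃ a p2, p1 = p2 * X + C a := ⟨_, _, (divX_mul_X_add p1).symm⟩
  obtain ⟨c, p3, rfl⟩ : ∃ a p3, p2 = p3 * X + C a := ⟨_, _, (divX_mul_X_add p2).symm⟩
  have key : ((p3 * X + C c) * X + C b) * X + C a
      = p3 * X ^ 3 + (C c * X ^ 2 + C b * X + C a) := by ring
  rw [key] at hp ⊢
  rw [map_add, I_le _ (I.mul_mem_left _ I_X3), zero_add] at hp
  simp only [map_add, map_mul, map_pow, ev_X, ev_C] at hp
  have h : ∀ a b c : ZMod 4, ι c * mk 0 1 0 ^ 2 + ι b * mk 0 1 0 + ι a = 0 →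
      a = 0 ∧ (b = 0 ∨ b = 2) ∧ (c = 0 ∨ c = 2) := by
    decide
  obtain ⟨rfl, hb, hc⟩ := h a b c hp
  have h2 : ∀ b : ZMod 4, (b = 0 ∨ b = 2) → C b * X ∈ I := by
    rintro b (rfl | rfl)
    · simp
    · exact I_2X
  refine I.add_mem (I.mul_mem_left _ I_X3) (I.add_mem (I.add_mem ?_ (h2 b hb)) (by simp))
  have : C c * X ^ 2 = X * (C c * X) := by ring
  rw [this]
  exact I.mul_mem_left _ (h2 c hc)

theorem ev_surj : Function.Surjective ev := by
  intro t
  have : ∀ t : TT_s7, ∃ a b c : ZMod 4, ι c * mk 0 1 0 ^ 2 + ι b * mk 0 1 0 + ι a = t := by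
    decide
  obtain ⟨a, b, c, h⟩ := this t
  exact ⟨C c * X ^ 2 + C b * X + C a, by simpa [ev_X, ev_C] using h⟩

theorem ker_eq : I = RingHom.ker ev := le_antisymm (fun p hp => I_le p hp) (fun p hp => ker_le p hp)

noncomputable def e : ((ZMod 4)[X] ⧸ I) ≃+* TT_s7 :=
  (Ideal.quotEquivOfEq ker_eq).trans (RingHom.quotientKerEquivOfSurjective ev_surj)

abbrev ZD (R : Type*) [CommRing R] := {x : R // x ≠ 0 ∧ ∃ y : R, y ≠ 0 ∧ x * y = 0}

def isoOf {R S : Type*} [CommRing R] [CommRing S] (e : R ≃+* S) :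
    zeroDivisorGraph R ≃g zeroDivisorGraph S where
  toEquiv := e.toEquiv.subtypeEquiv (by
    intro x
    refine and_congr (not_congr (map_eq_zero_iff e e.injective).symm) ?_
    constructor
    · rintro ⟨y, hy, h⟩
      exact ⟨e y, by simpa using hy, by simpa using congrArg e h⟩
    · rintro ⟨y, hy, h⟩
      exact ⟨e.symm y, by simpa using hy, by
        apply e.injective; simpa using h⟩)
  map_rel_iff' := by
    intro u v
    simp only [zeroDivisorGraph, ne_eq, EmbeddingLike.apply_eq_iff_eq]
    refine and_congr Iff.rfl ?_
    change e u.1 * e v.1 = 0 ↔ _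
    rw [← map_mul, map_eq_zero_iff e e.injective]

abbrev V : Fin 4 → Type := ![Fin 1, Fin 1, Fin 1, Fin 4]

instance fV : ∀ i, Fintype (V i)
  | 0 => inferInstanceAs (Fintype (Fin 1))
  | 1 => inferInstanceAs (Fintype (Fin 1))
  | 2 => inferInstanceAs (Fintype (Fin 1))
  | 3 => inferInstanceAs (Fintype (Fin 4))

instance dV : ∀ i, DecidableEq (V i)
  | 0 => inferInstanceAs (DecidableEq (Fin 1))
  | 1 => inferInstanceAs (DecidableEq (Fin 1))
  | 2 => inferInstanceAs (DecidableEq (Fin 1))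
  | 3 => inferInstanceAs (DecidableEq (Fin 4))

def F : ∀ i, V i → TT_s7
  | 0 => fun _ => mk 2 0 0
  | 1 => fun _ => mk 0 0 1
  | 2 => fun _ => mk 2 0 1
  | 3 => fun j => (![mk 0 1 0, mk 2 1 0, mk 0 1 1, mk 2 1 1] : Fin 4 → TT_s7) j

theorem F_zd : ∀ (i : Fin 4) (j : V i), F i j ≠ 0 ∧ ∃ y : TT_s7, y ≠ 0 ∧ F i j * y = 0 := by
  decide
theorem F_inj : ∀ (i : Fin 4) (j : V i) (i' : Fin 4) (j' : V i'), F i j = F i' j' →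
    (⟨i, j⟩ : Σ i, V i) = ⟨i', j'⟩ := by
  decide
theorem F_surj : ∀ x : TT_s7, (x ≠ 0 ∧ ∃ y : TT_s7, y ≠ 0 ∧ x * y = 0) → ∃ i j, F i j = x := by
  decide
theorem F_adj : ∀ (i : Fin 4) (j : V i) (i' : Fin 4) (j' : V i'),
    (F i j ≠ F i' j' ∧ F i j * F i' j' = 0) ↔ i ≠ i' := by
  decide

noncomputable def iso2 : SimpleGraph.completeMultipartiteGraph V ≃g zeroDivisorGraph TT_s7 where
  toEquiv := Equiv.ofBijective (fun s => ⟨F s.1 s.2, F_zd s.1 s.2⟩) (by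
    constructor
    · rintro ⟨i, j⟩ ⟨i', j'⟩ h
      exact F_inj i j i' j' (congrArg Subtype.val h)
    · rintro ⟨x, hx⟩
      obtain ⟨i, j, h⟩ := F_surj x hx
      exact ⟨⟨i, j⟩, Subtype.ext h⟩)
  map_rel_iff' := by
    rintro ⟨i, j⟩ ⟨i', j'⟩
    refine Iff.trans ?_ (F_adj i j i' j')
    exact and_congr (not_congr Subtype.ext_iff) Iff.rfl

end TT_s7

/-- `Γ((ZMod 4)[x]/(x^3, 2x))` is isomorphic to the complete multipartite
graph `K_{1,1,1,4}`. -/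
theorem stmt7 :
    Nonempty (zeroDivisorGraph
      ((ZMod 4)[X] ⧸ Ideal.span {(X : (ZMod 4)[X]) ^ 3, 2 * (X : (ZMod 4)[X])}) ≃g
      SimpleGraph.completeMultipartiteGraph ![Fin 1, Fin 1, Fin 1, Fin 4]) := by
  exact ⟨(TT_s7.isoOf TT_s7.e).trans TT_s7.iso2.symm⟩
end

section
/- Let F be a finite field with q elements, let ψ : F → Z/qZ be a bijection with ψ(0) = 0, and let R be any commutative ring. Then the map φ : R × F → R × Z/qZ defined by φ(a, b) = (a, ψ(b)) induces an injective graph homomorphism from the zero-divisor graph Γ(R × F) to the zero-divisor graph Γ(R × Z/qZ); that is, φ maps every nonzero zero-divisor of R × F to a nonzero zero-divisor of R × Z/qZ, φ is injective, and whenever u and v are distinct nonzero zero-divisors of R × F with uv = 0, we have φ(u)φ(v) = 0. -/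
/-- If `F` is a finite field with `q` elements, `ψ : F → ZMod q` is a bijection
with `ψ 0 = 0`, and `R` is any commutative ring, then `φ(a, b) = (a, ψ b)` induces an
injective graph homomorphism from `Γ(R × F)` to `Γ(R × ZMod q)`: it is injective, sends
nonzero zero-divisors to nonzero zero-divisors, and sends pairs of distinct nonzero
zero-divisors with product zero to pairs with product zero. -/
theorem stmt8 (q : ℕ) (F : Type*) [Field F] [Fintype F] (hq : Fintype.card F = q)
    (ψ : F → ZMod q) (hψ : Function.Bijective ψ) (hψ0 : ψ 0 = 0)
    (R : Type*) [CommRing R] :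
    Function.Injective (fun x : R × F => ((x.1, ψ x.2) : R × ZMod q)) ∧
    (∀ u : R × F, u ≠ 0 → (∃ v : R × F, v ≠ 0 ∧ u * v = 0) →
      ((u.1, ψ u.2) : R × ZMod q) ≠ 0 ∧
        ∃ w : R × ZMod q, w ≠ 0 ∧ ((u.1, ψ u.2) : R × ZMod q) * w = 0) ∧
    (∀ u v : R × F, u ≠ v → u ≠ 0 → v ≠ 0 → u * v = 0 →
      ((u.1, ψ u.2) : R × ZMod q) * ((v.1, ψ v.2) : R × ZMod q) = 0) := by
  have hinj : Function.Injective (fun x : R × F => ((x.1, ψ x.2) : R × ZMod q)) := by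
    rintro ⟨a, b⟩ ⟨c, d⟩ h
    simp only [Prod.mk.injEq] at h
    exact Prod.ext h.1 (hψ.1 h.2)
  have hne : ∀ u : R × F, u ≠ 0 → ((u.1, ψ u.2) : R × ZMod q) ≠ 0 := by
    intro u hu h
    apply hu
    apply hinj
    change ((u.1, ψ u.2) : R × ZMod q) = (0, ψ 0)
    rw [h, hψ0]
    rfl
  have hmul : ∀ u v : R × F, u * v = 0 →
      ((u.1, ψ u.2) : R × ZMod q) * ((v.1, ψ v.2) : R × ZMod q) = 0 := by
    intro u v h
    have h1 : u.1 * v.1 = 0 := congrArg Prod.fst h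
    have h2 : u.2 * v.2 = 0 := congrArg Prod.snd h
    refine Prod.ext h1 ?_
    change ψ u.2 * ψ v.2 = 0
    rcases mul_eq_zero.mp h2 with h | h <;> simp [h, hψ0]
  refine ⟨hinj, ?_, fun u v _ _ _ h => hmul u v h⟩
  rintro u hu ⟨v, hv, huv⟩
  exact ⟨hne u hu, _, hne v hv, hmul u v huv⟩
end

section
/- Let (R, m) be a finite local commutative ring with |R| = 64 whose residue field R/m has 8 elements and such that m^2 = 0. If the characteristic of R is 2, then R is isomorphic as a ring to F_8[x]/(x^2), where F_8 is the field with eight elements. -/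
open Polynomial

/-- If `(R, m)` is a finite local commutative ring with `|R| = 64`, residue
field of 8 elements, `m^2 = 0`, and characteristic 2, then `R ≃ F₈[x]/(x^2)`. -/
theorem stmt14 (R : Type*) [CommRing R] [IsLocalRing R] [Finite R]
    (hcard : Nat.card R = 64)
    (hres : Nat.card (IsLocalRing.ResidueField R) = 8)
    (hm : IsLocalRing.maximalIdeal R ^ 2 = ⊥)
    (hchar : ringChar R = 2) :
    Nonempty (R ≃+* ((GaloisField 2 3)[X] ⧸ Ideal.span {(X : (GaloisField 2 3)[X]) ^ 2})) := by
  have hC : CharP R 2 := hchar ▸ ringChar.charP R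
  have hmul : ∀ x ∈ IsLocalRing.maximalIdeal R, x ^ 2 = 0 := by
    intro x hx
    have := Ideal.pow_mem_pow hx 2
    rwa [hm, Ideal.mem_bot] at this
  let s : IsLocalRing.ResidueField R →+* R :=
    Ideal.Quotient.lift (IsLocalRing.maximalIdeal R) (iterateFrobenius R 2 3) (by
      intro x hx
      rw [iterateFrobenius_def]
      have := hmul x hx
      calc x ^ 2 ^ 3 = (x ^ 2) ^ 4 := by ring
        _ = 0 := by rw [this]; ring)
  have hG : Nat.card (GaloisField 2 3) = 8 := by
    rw [GaloisField.card 2 3 (by norm_num)]; norm_num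
  have : Finite (IsLocalRing.ResidueField R) := Nat.finite_of_card_ne_zero (by omega)
  have : Finite (GaloisField 2 3) := Nat.finite_of_card_ne_zero (by omega)
  letI := Fintype.ofFinite (IsLocalRing.ResidueField R)
  letI := Fintype.ofFinite (GaloisField 2 3)
  have e : GaloisField 2 3 ≃+* IsLocalRing.ResidueField R :=
    FiniteField.ringEquivOfCardEq (K := GaloisField 2 3) (K' := IsLocalRing.ResidueField R)
      (by rw [← Nat.card_eq_fintype_card, ← Nat.card_eq_fintype_card, hG, hres])
  let f : GaloisField 2 3 →+* R := s.comp e.toRingHom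
  have hf : ∀ a, f a ∈ IsLocalRing.maximalIdeal R → a = 0 := by
    intro a ha
    by_contra h
    exact (IsLocalRing.mem_maximalIdeal _).1 ha ((IsUnit.mk0 a h).map f)
  obtain ⟨t, ht, ht0⟩ : ∃ t ∈ IsLocalRing.maximalIdeal R, t ≠ 0 := by
    by_contra! h
    have hinj : Function.Injective (IsLocalRing.residue R) := by
      rw [injective_iff_map_eq_zero]
      intro a ha
      exact h a ((IsLocalRing.residue_eq_zero_iff a).1 ha)
    have := Nat.card_le_card_of_injective _ hinj
    omega
  have key : ∀ a b, f a + f b * t = 0 → a = 0 ∧ b = 0 := by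
    intro a b h
    have ha : a = 0 := hf a (by
      rw [eq_neg_of_add_eq_zero_left h]
      exact neg_mem (Ideal.mul_mem_left _ _ ht))
    refine ⟨ha, ?_⟩
    by_contra hb
    rw [ha, map_zero, zero_add] at h
    exact ht0 (((IsUnit.mk0 b hb).map f).mul_right_eq_zero.1 h)
  let g : GaloisField 2 3 × GaloisField 2 3 → R := fun p => f p.1 + f p.2 * t
  have hginj : Function.Injective g := by
    rintro ⟨a, b⟩ ⟨c, d⟩ h
    have := key (a - c) (b - d) (by
      simp only [g] at h
      rw [map_sub, map_sub]; linear_combination h)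
    rw [sub_eq_zero, sub_eq_zero] at this
    exact Prod.ext this.1 this.2
  have hg : Function.Bijective g :=
    (Nat.bijective_iff_injective_and_card g).2 ⟨hginj, by rw [Nat.card_prod, hG, hcard]⟩
  have hX : ∀ p ∈ Ideal.span {(X : (GaloisField 2 3)[X]) ^ 2}, eval₂RingHom f t p = 0 := by
    intro p hp
    obtain ⟨q, rfl⟩ := Ideal.mem_span_singleton.1 hp
    simp [hmul t ht]
  refine ⟨(RingEquiv.ofBijective (Ideal.Quotient.lift _ (eval₂RingHom f t) hX) ⟨?_, ?_⟩).symm⟩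
  · rw [injective_iff_map_eq_zero]
    intro x hx
    obtain ⟨p, rfl⟩ := Ideal.Quotient.mk_surjective x
    rw [Ideal.Quotient.lift_mk] at hx
    rw [Ideal.Quotient.eq_zero_iff_mem, Ideal.mem_span_singleton, X_pow_dvd_iff]
    have h1 := divX_mul_X_add p
    have h2 := divX_mul_X_add p.divX
    rw [← h1, ← h2] at hx
    simp only [coe_eval₂RingHom, eval₂_add, eval₂_mul_X, eval₂_C, coeff_divX] at hx
    have := key (p.coeff 0) (p.coeff 1) (by
      linear_combination hx - (eval₂ f t p.divX.divX) * hmul t ht)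
    intro d hd
    interval_cases d
    · exact this.1
    · exact this.2
  · intro y
    obtain ⟨⟨a, b⟩, rfl⟩ := hg.2 y
    exact ⟨Ideal.Quotient.mk _ (C a + C b * X), by simp [g]⟩
end

section
/- Let (R, m) be a finite local commutative ring with |R| = 49 whose residue field R/m has 7 elements and such that m^2 = 0. If the characteristic of R is 7, then R is isomorphic as a ring to (Z/7Z)[x]/(x^2). -/
open Polynomial

/-- If `(R, m)` is a finite local commutative ring with `|R| = 49`, residue
field of 7 elements, `m^2 = 0`, and characteristic 7, then `R ≃ (ZMod 7)[x]/(x^2)`. -/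
theorem stmt16 (R : Type*) [CommRing R] [IsLocalRing R] [Finite R]
    (hcard : Nat.card R = 49)
    (hres : Nat.card (IsLocalRing.ResidueField R) = 7)
    (hm : IsLocalRing.maximalIdeal R ^ 2 = ⊥)
    (hchar : ringChar R = 7) :
    Nonempty (R ≃+* ((ZMod 7)[X] ⧸ Ideal.span {(X : (ZMod 7)[X]) ^ 2})) := by
  haveI : Fact (Nat.Prime 7) := ⟨by norm_num⟩
  haveI : CharP R 7 := by rw [← hchar]; infer_instance
  letI : Algebra (ZMod 7) R := ZMod.algebra R 7
  have hne : IsLocalRing.maximalIdeal R ≠ ⊥ := by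
    intro h
    have hinj : Function.Injective (IsLocalRing.residue R) := by
      rw [RingHom.injective_iff_ker_eq_bot, IsLocalRing.ker_residue, h]
    have h1 := Nat.card_congr (Equiv.ofBijective _ ⟨hinj, IsLocalRing.residue_surjective⟩)
    omega
  obtain ⟨t, htm, ht0⟩ := Submodule.exists_mem_ne_zero_of_ne_bot hne
  have ht2 : t ^ 2 = 0 := by
    have : t ^ 2 ∈ IsLocalRing.maximalIdeal R ^ 2 := Ideal.pow_mem_pow htm 2
    rw [hm] at this
    exact (Ideal.mem_bot).1 this
  have hunit : ∀ a : ZMod 7, a ≠ 0 → IsUnit (algebraMap (ZMod 7) R a) := fun a ha =>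
    (IsUnit.mk0 a ha).map _
  have key : ∀ a b : ZMod 7, algebraMap (ZMod 7) R a + algebraMap (ZMod 7) R b * t = 0 →
      a = 0 ∧ b = 0 := by
    intro a b h
    have ha : a = 0 := by
      by_contra ha
      have h1 : algebraMap (ZMod 7) R a ∈ IsLocalRing.maximalIdeal R := by
        rw [eq_neg_of_add_eq_zero_left h]
        exact neg_mem (Ideal.mul_mem_left _ _ htm)
      exact (IsLocalRing.mem_maximalIdeal _).1 h1 (hunit a ha)
    refine ⟨ha, ?_⟩
    by_contra hb
    rw [ha, map_zero, zero_add, (hunit b hb).mul_right_eq_zero] at h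
    exact ht0 h
  let g : ZMod 7 × ZMod 7 → R := fun x =>
    algebraMap (ZMod 7) R x.1 + algebraMap (ZMod 7) R x.2 * t
  have ginj : Function.Injective g := by
    intro x y h
    have h' := key (x.1 - y.1) (x.2 - y.2) (by
      have h2 := sub_eq_zero.2 h
      simp only [g] at h2
      rw [map_sub, map_sub, ← h2]; ring)
    exact Prod.ext (sub_eq_zero.1 h'.1) (sub_eq_zero.1 h'.2)
  have gsurj : Function.Surjective g :=
    (ginj.bijective_of_nat_card_le (by rw [hcard, Nat.card_prod, Nat.card_zmod])).2
  let f : (ZMod 7)[X] →+* R := (aeval t : (ZMod 7)[X] →ₐ[ZMod 7] R).toRingHom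
  have hf : ∀ p, f p = aeval t p := fun _ => rfl
  have fsurj : Function.Surjective f := by
    intro r
    obtain ⟨x, rfl⟩ := gsurj r
    exact ⟨C x.1 + C x.2 * X, by simp [hf, g]⟩
  have hker : RingHom.ker f = Ideal.span {(X : (ZMod 7)[X]) ^ 2} := by
    ext p
    rw [RingHom.mem_ker, Ideal.mem_span_singleton]
    constructor
    · intro h
      have e : f p = algebraMap (ZMod 7) R (p.coeff 0)
          + algebraMap (ZMod 7) R (p.coeff 1) * t := by
        conv_lhs => rw [← divX_mul_X_add p, ← divX_mul_X_add p.divX]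
        simp only [hf, map_add, map_mul, aeval_X, aeval_C, coeff_divX, zero_add]
        linear_combination (aeval t p.divX.divX) * ht2
      rw [e] at h
      obtain ⟨h0, h1⟩ := key _ _ h
      rw [X_pow_dvd_iff]
      intro d hd
      interval_cases d
      · exact h0
      · exact h1
    · rintro ⟨q, rfl⟩
      simp [hf, ht2]
  exact ⟨((Ideal.quotEquivOfEq hker.symm).trans
    (RingHom.quotientKerEquivOfSurjective fsurj)).symm⟩
end

section
/- Let (R, m) be a finite local commutative ring with |R| = 8 such that m^2 ≠ 0. If the characteristic of R is 4, then R is isomorphic as a ring to (Z/4Z)[x]/(x^3, x^2 - 2). -/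
open Polynomial

lemma aux_idx {G : Type*} [AddCommGroup G] [Finite G] (H K : AddSubgroup G) (h : H ≤ K)
    (hc : Nat.card K = 2 * Nat.card H) {a b : G} (ha : a ∈ K) (hb : b ∈ K)
    (ha' : a ∉ H) (hb' : b ∉ H) : a - b ∈ H := by
  have h1 : (H.addSubgroupOf K).index = 2 := by
    have h2 := (H.addSubgroupOf K).card_mul_index
    rw [Nat.card_congr (AddSubgroup.addSubgroupOfEquivOfLe h).toEquiv, hc, mul_comm] at h2
    exact Nat.eq_of_mul_eq_mul_right Nat.card_pos h2
  have := (AddSubgroup.add_mem_iff_of_index_two h1 (a := ⟨a, ha⟩) (b := -⟨b, hb⟩))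
  simp only [AddSubgroup.mem_addSubgroupOf] at this
  rw [sub_eq_add_neg]
  refine this.2 ?_
  simp [ha', hb']

lemma aux_idl {R : Type*} [CommRing R] [Finite R] (I J : Ideal R) (h : I ≤ J) (n k : ℕ)
    (hJ : Nat.card J = n) (hI : Nat.card I = k) (hn : n = 2 * k) {a b : R} (ha : a ∈ J) (hb : b ∈ J)
    (ha' : a ∉ I) (hb' : b ∉ I) : a - b ∈ I := by
  subst hJ hI
  exact aux_idx I.toAddSubgroup J.toAddSubgroup h hn ha hb ha' hb'

lemma aux_card {R : Type*} [CommRing R] [Finite R] {I J : Ideal R} (h : I < J) :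
    Nat.card I ∣ Nat.card J ∧ Nat.card I < Nat.card J := by
  refine ⟨AddSubgroup.card_dvd_of_le (H := I.toAddSubgroup) (K := J.toAddSubgroup) h.le, ?_⟩
  exact Set.ncard_lt_ncard (s := (I : Set R)) (t := J) h (Set.toFinite _)

set_option maxHeartbeats 1000000 in
/-- If `(R, m)` is a finite local commutative ring with `|R| = 8`, `m^2 ≠ 0`,
and characteristic 4, then `R ≃ (ZMod 4)[x]/(x^3, x^2 - 2)`. -/
theorem stmt18 (R : Type*) [CommRing R] [IsLocalRing R] [Finite R]
    (hcard : Nat.card R = 8)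
    (hm : IsLocalRing.maximalIdeal R ^ 2 ≠ ⊥)
    (hchar : ringChar R = 4) :
    Nonempty (R ≃+*
      ((ZMod 4)[X] ⧸ Ideal.span {(X : (ZMod 4)[X]) ^ 3, (X : (ZMod 4)[X]) ^ 2 - 2})) := by
  have hcp : CharP R 4 := hchar ▸ ringChar.charP R
  set m := IsLocalRing.maximalIdeal R with hmdef
  have h4 : (4 : R) = 0 := by exact_mod_cast CharP.cast_eq_zero R 4
  have h2 : (2 : R) ≠ 0 := by
    intro h
    have := (CharP.cast_eq_zero_iff R 4 2).1 (by exact_mod_cast h)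
    omega
  have hlt (k : ℕ) (hk : m ^ k ≠ ⊥) : m ^ (k+1) < m ^ k := by
    refine lt_of_le_of_ne (Ideal.pow_le_pow_right (by omega)) fun h => hk ?_
    refine Submodule.eq_bot_of_le_smul_of_le_jacobson_bot m _ (IsNoetherian.noetherian _) ?_
      (IsLocalRing.maximalIdeal_le_jacobson _)
    rw [smul_eq_mul, ← pow_succ', h]
  have hmb : m ^ 1 ≠ ⊥ := fun h => hm (by rw [pow_one] at h; rw [h]; simp [pow_two])
  have c0 := aux_card (hlt 0 (by simp))
  have c1 := aux_card (hlt 1 hmb)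
  have c2 := aux_card (hlt 2 hm)
  have ct : Nat.card (m^0 : Ideal R) = 8 := by
    rw [pow_zero, Ideal.one_eq_top, ← hcard]
    exact Nat.card_congr (Equiv.Set.univ R)
  simp only [zero_add, Nat.reduceAdd, ct] at c0 c1 c2
  have p3 : 0 < Nat.card (m^3 : Ideal R) := Nat.card_pos
  have key : Nat.card (m^1 : Ideal R) = 4 ∧ Nat.card (m^2 : Ideal R) = 2 ∧
      Nat.card (m^3 : Ideal R) = 1 := by
    generalize Nat.card (m^1 : Ideal R) = x at *
    generalize Nat.card (m^2 : Ideal R) = y at *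
    generalize Nat.card (m^3 : Ideal R) = z at *
    obtain ⟨⟨a1, b1⟩, ⟨a2, b2⟩, ⟨a3, b3⟩⟩ := And.intro c0 (And.intro c1 c2)
    interval_cases x <;> interval_cases y <;> interval_cases z <;> simp_all
  obtain ⟨k1, k2, k3⟩ := key
  have m3 : m ^ 3 = ⊥ := by
    by_contra h
    have := (aux_card (bot_lt_iff_ne_bot.2 h)).2
    rw [k3] at this
    have : 0 < Nat.card (⊥ : Ideal R) := Nat.card_pos
    omega
  have mul0 {u v : R} (hu : u ∈ m) (hv : v ∈ m ^ 2) : u * v = 0 := by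
    have : u * v ∈ m ^ 3 := by rw [pow_succ' m 2]; exact Ideal.mul_mem_mul hu hv
    simpa [m3] using this
  have mulm {u v : R} (hu : u ∈ m) (hv : v ∈ m) : u * v ∈ m ^ 2 := by
    rw [pow_two]; exact Ideal.mul_mem_mul hu hv
  have d1 {u v : R} (hu : u ∈ m) (hv : v ∈ m) (hu' : u ∉ m ^ 2) (hv' : v ∉ m ^ 2) :
      u - v ∈ m ^ 2 := by
    exact aux_idl (m^2) (m^1) (hlt 1 hmb).le 4 2 k1 k2 rfl (by simpa using hu) (by simpa using hv)
      hu' hv'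
  have d0 {u : R} (hu : u ∉ m) : u - 1 ∈ m := by
    have := aux_idl (m^1) (m^0) (hlt 0 (by simp)).le 8 4 ct k1 rfl (a := u) (b := 1)
      (by simp) (by simp) (by simpa using hu) (by simp [hmdef])
    simpa using this
  have d2 {u v : R} (hu : u ∈ m ^ 2) (hv : v ∈ m ^ 2) (hu' : u ≠ 0) (hv' : v ≠ 0) : u = v := by
    have := aux_idl (m^3) (m^2) (hlt 2 hm).le 2 1 k2 k3 rfl (a := u) (b := v)
      hu hv (by simpa [m3] using hu') (by simpa [m3] using hv')
    simpa [m3, sub_eq_zero] using this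
  have hex : ∃ a ∈ m, ∃ b ∈ m, a * b ≠ 0 := by
    by_contra! h
    apply hm
    rw [pow_two, eq_bot_iff, Ideal.mul_le]
    intro r hr s hs
    simpa using h r hr s hs
  obtain ⟨a, ha, b, hb, hab⟩ := hex
  have ha2 : a ∉ m ^ 2 := fun h => hab (by rw [mul_comm]; exact mul0 hb h)
  have hb2 : b ∉ m ^ 2 := fun h => hab (mul0 ha h)
  have haa : a * a ≠ 0 := by
    have := mul0 ha (d1 ha hb ha2 hb2)
    rw [mul_sub, sub_eq_zero] at this
    rwa [this]
  have h2m : (2 : R) ∈ m := by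
    rw [hmdef, IsLocalRing.mem_maximalIdeal]
    intro h
    exact h2 (h.mul_left_cancel (by rw [mul_zero]; linear_combination h4))
  have h22 : (2 : R) ∈ m ^ 2 := by
    by_contra h
    have e1 := d1 ha h2m ha2 h
    have e2 := mul0 ha e1
    have e3 := mul0 h2m e1
    apply haa
    linear_combination e2 + e3 + h4
  have hsq : a * a = 2 := d2 (mulm ha ha) h22 haa h2
  have h2a : a * 2 = 0 := mul0 ha h22
  let I : Ideal (ZMod 4)[X] := Ideal.span {(X : (ZMod 4)[X]) ^ 3, (X : (ZMod 4)[X]) ^ 2 - 2}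
  let φ : (ZMod 4)[X] →+* R := eval₂RingHom (ZMod.castHom (dvd_refl 4) R) a
  have φX : φ X = a := by simp [φ]
  have φC (c : ZMod 4) : φ (C c) = ZMod.castHom (dvd_refl 4) R c := by simp [φ]
  have hI : ∀ p ∈ I, φ p = 0 := by
    intro p hp
    have : I ≤ RingHom.ker φ := by
      rw [Ideal.span_le]
      rintro q (rfl | rfl)
      · simp only [SetLike.mem_coe, RingHom.mem_ker, map_pow, φX]
        linear_combination a * hsq + h2a
      · simp only [SetLike.mem_coe, RingHom.mem_ker, map_pow, map_sub, φX, map_ofNat]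
        linear_combination hsq
    exact this hp
  have g1 : (X : (ZMod 4)[X]) ^ 3 ∈ I := Ideal.subset_span (by simp)
  have g2 : (X : (ZMod 4)[X]) ^ 2 - 2 ∈ I := Ideal.subset_span (by simp)
  have g3 : C 2 * (X : (ZMod 4)[X]) ∈ I := by
    have := I.sub_mem g1 (I.mul_mem_left X g2)
    convert this using 1
    rw [show (C 2 : (ZMod 4)[X]) = 2 from rfl]
    ring
  have hinj : ∀ p, φ p = 0 → p ∈ I := by
    intro p hp
    have cases4 : ∀ c : ZMod 4, c = 0 ∨ c = 1 ∨ c = 2 ∨ c = 3 := by decide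
    have : Nontrivial (ZMod 4) := ⟨0, 1, by decide⟩
    have hmon : (X ^ 2 - C 2 : (ZMod 4)[X]).Monic := monic_X_pow_sub_C 2 (by norm_num)
    have hdeg : (p %ₘ (X ^ 2 - C 2)).degree ≤ 1 := by
      have := degree_modByMonic_lt p hmon
      rw [degree_X_pow_sub_C (by norm_num)] at this
      exact Order.le_of_lt_succ this
    have hr := eq_X_add_C_of_degree_le_one hdeg
    have hd := modByMonic_add_div p (X ^ 2 - C 2)
    rw [hr] at hd
    generalize (p %ₘ (X ^ 2 - C 2)).coeff 1 = d at hd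
    generalize (p %ₘ (X ^ 2 - C 2)).coeff 0 = c at hd
    have hq : (X ^ 2 - C 2) * (p /ₘ (X ^ 2 - C 2)) ∈ I := I.mul_mem_right _ g2
    have e : ZMod.castHom (dvd_refl 4) R d * a + ZMod.castHom (dvd_refl 4) R c = 0 := by
      have := congrArg φ hd
      rw [map_add, hI _ hq, hp] at this
      simpa [φX, φC] using this
    rw [← hd]
    refine I.add_mem ?_ hq
    have one : (1 : R) ∉ m := by simp [hmdef]
    have n0 : (0:R) ∈ m := m.zero_mem
    have v0 : ZMod.castHom (dvd_refl 4) R 0 = 0 := map_zero _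
    have v1 : ZMod.castHom (dvd_refl 4) R 1 = 1 := map_one _
    have v2 : ZMod.castHom (dvd_refl 4) R 2 = 2 := map_ofNat _ 2
    have v3 : ZMod.castHom (dvd_refl 4) R 3 = 3 := map_ofNat _ 3
    have hcm : ZMod.castHom (dvd_refl 4) R c ∈ m := by
      rw [← neg_eq_of_add_eq_zero_right e]
      exact m.neg_mem (m.mul_mem_left _ ha)
    have hc : c = 0 ∨ c = 2 := by
      have : c = 0 ∨ c = 1 ∨ c = 2 ∨ c = 3 := cases4 c
      rcases this with rfl | rfl | rfl | rfl
      · simp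
      · rw [v1] at hcm; exact absurd hcm one
      · simp
      · rw [v3] at hcm
        refine absurd ?_ one
        have := m.sub_mem hcm h2m
        norm_num at this
        exact this
    have hc2 : ZMod.castHom (dvd_refl 4) R c ∈ m ^ 2 := by
      rcases hc with rfl | rfl
      · rw [v0]; exact zero_mem _
      · rw [v2]; exact h22
    have hda : ZMod.castHom (dvd_refl 4) R d * a ∈ m ^ 2 := by
      rw [eq_neg_of_add_eq_zero_left e]
      exact neg_mem hc2
    have hd' : d = 0 ∨ d = 2 := by
      have : d = 0 ∨ d = 1 ∨ d = 2 ∨ d = 3 := cases4 d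
      rcases this with rfl | rfl | rfl | rfl
      · simp
      · rw [v1, one_mul] at hda; exact absurd hda ha2
      · simp
      · rw [v3] at hda
        refine absurd ?_ ha2
        have : a = 3 * a := by linear_combination -h2a
        rwa [this]
    have hda0 : ZMod.castHom (dvd_refl 4) R d * a = 0 := by
      rcases hd' with rfl | rfl
      · rw [v0, zero_mul]
      · rw [v2, mul_comm, h2a]
    rw [hda0, zero_add] at e
    have hc0 : c = 0 := by
      rcases hc with rfl | rfl
      · rfl
      · rw [v2] at e; exact absurd e h2
    rw [hc0, C_0, add_zero]
    rcases hd' with rfl | rfl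
    · simp
    · exact g3
  have hsurj : Function.Surjective φ := by
    have s2 : ∀ r ∈ m ^ 2, r ∈ φ.range := by
      intro r hr
      by_cases h : r = 0
      · rw [h]; exact zero_mem _
      · rw [d2 hr h22 h h2]; exact ⟨2, map_ofNat _ 2⟩
    have s1 : ∀ r ∈ m, r ∈ φ.range := by
      intro r hr
      by_cases h : r ∈ m ^ 2
      · exact s2 r h
      · have := add_mem (s2 _ (d1 hr ha h ha2)) (show a ∈ φ.range from ⟨X, φX⟩)
        simpa using this
    intro r
    change r ∈ φ.range
    by_cases h : r ∈ m
    · exact s1 r h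
    · have := add_mem (s1 _ (d0 h)) (one_mem φ.range)
      simpa using this
  have hker : I = RingHom.ker φ := le_antisymm hI hinj
  exact ⟨((Ideal.quotEquivOfEq hker).trans (RingHom.quotientKerEquivOfSurjective hsurj)).symm⟩
end
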